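/- arXiv:2512.05195 — 6 statements merged into one kernel-verified Lean document; each statement's English description precedes it below -/
import Mathlib

section
/- Let n ≥ 1 and d ≥ 0. Every harmonic homogeneous polynomial of degree d in ℂ[x_0,…,x_n] lies in the ℂ-linear span of the set { ℓ^d : ℓ an isotropic linear form in ℂ[x_0,…,x_n] }. -/
open MvPolynomial

/-- The linear form with coefficient vector `a`. -/
noncomputable def lin {n : ℕ} (a : Fin n → ℂ) : MvPolynomial (Fin n) ℂ :=
  ∑ i, MvPolynomial.C (a i) * MvPolynomial.X i

/-- The Laplace operator `Δ = ∑ ∂²/∂xᵢ²`. -/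
noncomputable def lap {n : ℕ} (p : MvPolynomial (Fin n) ℂ) : MvPolynomial (Fin n) ℂ :=
  ∑ i, MvPolynomial.pderiv i (MvPolynomial.pderiv i p)

/-- A coefficient vector (linear form) is isotropic if `∑ aᵢ² = 0`. -/
def Isotropic {n : ℕ} (a : Fin n → ℂ) : Prop :=
  ∑ i, (a i) ^ 2 = 0

/-- Isotropic rank: least `r` such that `h` is a sum of `r` `d`-th powers of
isotropic linear forms. -/
noncomputable def irk {n : ℕ} (d : ℕ) (h : MvPolynomial (Fin n) ℂ) : ℕ :=
  sInf {r : ℕ | ∃ ℓ : Fin r → (Fin n → ℂ),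
    (∀ j, Isotropic (ℓ j)) ∧ h = ∑ j, (lin (ℓ j)) ^ d}

/-- Waring rank: least `r` such that `h` is a sum of `r` `d`-th powers of
linear forms. -/
noncomputable def wrk {n : ℕ} (d : ℕ) (h : MvPolynomial (Fin n) ℂ) : ℕ :=
  sInf {r : ℕ | ∃ ℓ : Fin r → (Fin n → ℂ), h = ∑ j, (lin (ℓ j)) ^ d}


theorem quad_dvd (n : ℕ) (hn : 1 ≤ n) (g : MvPolynomial (Fin (n + 1)) ℂ)
    (hg : ∀ a : Fin (n + 1) → ℂ, Isotropic a → eval a g = 0) :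
    ∃ f, g = (∑ i, X i * X i) * f := by
  set Q' : MvPolynomial (Fin n) ℂ := ∑ i, X i * X i with hQ'
  set P : Polynomial (MvPolynomial (Fin n) ℂ) := Polynomial.X ^ 2 + Polynomial.C Q' with hP
  have hmon : P.Monic := Polynomial.monic_X_pow_add_C Q' (by norm_num)
  have hnd : P.natDegree = 2 := Polynomial.natDegree_X_pow_add_C
  have hP1 : P ≠ 1 := by
    intro h
    rw [h] at hnd
    simp at hnd
  have hr := Polynomial.natDegree_modByMonic_lt (finSuccEquiv ℂ n g) hmon hP1
  obtain ⟨A, B, hAB⟩ := Polynomial.exists_eq_X_add_C_of_natDegree_le_one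
    (show (finSuccEquiv ℂ n g %ₘ P).natDegree ≤ 1 by omega)
  have hdiv := Polynomial.modByMonic_add_div (finSuccEquiv ℂ n g) P
  rw [hAB] at hdiv
  have key : ∀ (s : Fin n → ℂ) (y : ℂ), y ^ 2 + eval s Q' = 0 →
      eval s A * y + eval s B = 0 := by
    intro s y hy
    have h1 : Isotropic (Fin.cons y s : Fin (n + 1) → ℂ) := by
      unfold Isotropic
      rw [Fin.sum_univ_succ]
      simp only [Fin.cons_zero, Fin.cons_succ]
      rw [← hy]
      simp [hQ', pow_two]
    have h2 := hg _ h1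
    rw [eval_eq_eval_mv_eval', ← hdiv] at h2
    simp [hP, hy] at h2
    exact h2
  have key2 : ∀ s : Fin n → ℂ, eval s B = 0 ∧ eval s (A * A * Q') = 0 := by
    intro s
    obtain ⟨y, hy⟩ := IsAlgClosed.exists_pow_nat_eq (-(eval s Q')) (n := 2) (by norm_num)
    have e1 := key s y (by rw [hy]; ring)
    have e2 := key s (-y) (by rw [neg_sq, hy]; ring)
    have hB : eval s B = 0 := by linear_combination (e1 + e2) / 2
    refine ⟨hB, ?_⟩
    have hA : eval s A * y = 0 := by linear_combination e1 - hB
    rw [map_mul, map_mul]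
    linear_combination (-(eval s A) * y) * hA - (eval s A)^2 * (-hy)
  have hB : B = 0 := MvPolynomial.funext fun s => by simpa using (key2 s).1
  have hA2 : A * A * Q' = 0 := MvPolynomial.funext fun s => by simpa using (key2 s).2
  have hQ0 : Q' ≠ 0 := by
    intro h
    have := congrArg (eval (Pi.single (⟨0, hn⟩ : Fin n) (1 : ℂ))) h
    simp [hQ', Pi.single_apply] at this
  have hA : A = 0 := by
    rcases mul_eq_zero.1 hA2 with h | h
    · exact mul_self_eq_zero.1 h
    · exact absurd h hQ0
  refine ⟨(finSuccEquiv ℂ n).symm (finSuccEquiv ℂ n g /ₘ P), ?_⟩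
  apply (finSuccEquiv ℂ n).injective
  rw [map_mul, AlgEquiv.apply_symm_apply]
  have : finSuccEquiv ℂ n (∑ i, X i * X i) = P := by
    rw [Fin.sum_univ_succ, map_add, map_mul, finSuccEquiv_X_zero, map_sum]
    simp [finSuccEquiv_X_succ, hP, hQ', pow_two]
  rw [this]
  conv_lhs => rw [← hdiv]
  simp [hA, hB]

/-- The apolar pairing with `h`, as a linear functional. -/
noncomputable def apolar {m : ℕ} (h : MvPolynomial (Fin m) ℂ) : MvPolynomial (Fin m) ℂ →ₗ[ℂ] ℂ :=
  (basisMonomials (Fin m) ℂ).constr ℂ fun α => ((∏ i, (α i).factorial : ℕ) : ℂ) * coeff α h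

theorem apolar_monomial {m : ℕ} (h : MvPolynomial (Fin m) ℂ) (α : Fin m →₀ ℕ) (c : ℂ) :
    apolar h (monomial α c) = c * (((∏ i, (α i).factorial : ℕ) : ℂ) * coeff α h) := by
  have h1 : monomial α c = c • basisMonomials (Fin m) ℂ α := by
    simp [smul_monomial]
  rw [h1, map_smul, apolar, Module.Basis.constr_basis, smul_eq_mul]

theorem apolar_X_mul {m : ℕ} (h f : MvPolynomial (Fin m) ℂ) (i : Fin m) :
    apolar h (X i * f) = apolar (pderiv i h) f := by
  induction f using MvPolynomial.induction_on' with
  | add p q hp hq => rw [mul_add, map_add, map_add, hp, hq]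
  | monomial α c =>
    have h1 : (X i : MvPolynomial (Fin m) ℂ) * monomial α c = monomial (α + Finsupp.single i 1) c := by
      rw [X, monomial_mul, one_mul, add_comm]
    rw [h1, apolar_monomial, apolar_monomial, coeff_pderiv]
    have h2 : ∏ j, ((α + Finsupp.single i 1 : Fin m →₀ ℕ) j).factorial = (α i + 1) * ∏ j, (α j).factorial := by
      rw [← Finset.mul_prod_erase _ _ (Finset.mem_univ i),
        ← Finset.mul_prod_erase _ (fun j => (α j).factorial) (Finset.mem_univ i)]
      rw [Finset.prod_congr rfl (g := fun j => (α j).factorial)]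
      · simp [Nat.factorial_succ, mul_assoc]
      · intro j hj
        simp [Finsupp.single_apply, (Finset.ne_of_mem_erase hj).symm]
    rw [h2]
    push_cast
    ring

theorem apolar_zero {m : ℕ} (f : MvPolynomial (Fin m) ℂ) : apolar 0 f = 0 := by
  induction f using MvPolynomial.induction_on' with
  | add p q hp hq => rw [map_add, hp, hq, add_zero]
  | monomial α c => simp [apolar_monomial]

theorem apolar_add {m : ℕ} (h k f : MvPolynomial (Fin m) ℂ) :
    apolar (h + k) f = apolar h f + apolar k f := by
  induction f using MvPolynomial.induction_on' with
  | add p q hp hq => simp only [map_add, hp, hq]; ring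
  | monomial α c => simp only [apolar_monomial, coeff_add]; ring

theorem apolar_quad {m : ℕ} (h f : MvPolynomial (Fin m) ℂ) :
    apolar h ((∑ i, X i * X i) * f) = apolar (lap h) f := by
  rw [Finset.sum_mul, map_sum, lap]
  have hs : ∀ (s : Finset (Fin m)) (u : Fin m → MvPolynomial (Fin m) ℂ),
      apolar (∑ i ∈ s, u i) f = ∑ i ∈ s, apolar (u i) f := by
    intro s u
    induction s using Finset.induction_on with
    | empty => simp [apolar_zero]
    | insert a s ha ih => rw [Finset.sum_insert ha, Finset.sum_insert ha, apolar_add, ih]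
  rw [hs]
  refine Finset.sum_congr rfl fun i _ => ?_
  rw [mul_assoc, apolar_X_mul, apolar_X_mul]

theorem homog_sum {m d : ℕ} (h : MvPolynomial (Fin m) ℂ) (hhom : h.IsHomogeneous d) :
    h = ∑ k ∈ Finset.piAntidiag Finset.univ d,
      monomial (Finsupp.equivFunOnFinite.symm k) (coeff (Finsupp.equivFunOnFinite.symm k) h) := by
  ext α
  rw [coeff_sum]
  simp only [coeff_monomial]
  by_cases hα : coeff α h = 0
  · rw [hα, Finset.sum_eq_zero]
    intro k _
    split_ifs with e
    · rw [e, hα]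
    · rfl
  · have hd : ∑ i, α i = d := by
      have := hhom hα
      rw [← this, Finsupp.weight_apply, Finsupp.sum_fintype] <;> simp
    rw [Finset.sum_eq_single (α : Fin m → ℕ)]
    · simp
    · intro k _ hk
      rw [if_neg]
      rintro rfl
      exact hk (by simp)
    · intro hk
      exact absurd (by simp [hd]) hk

/-- The generating polynomial of a functional on forms of degree `d`. -/
noncomputable def genPoly {m : ℕ} (d : ℕ) (φ : MvPolynomial (Fin m) ℂ →ₗ[ℂ] ℂ) :
    MvPolynomial (Fin m) ℂ :=
  ∑ k ∈ Finset.piAntidiag Finset.univ d,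
    monomial (Finsupp.equivFunOnFinite.symm k)
      ((Nat.multinomial Finset.univ k : ℂ) * φ (monomial (Finsupp.equivFunOnFinite.symm k) 1))

theorem eval_genPoly {m : ℕ} (d : ℕ) (φ : MvPolynomial (Fin m) ℂ →ₗ[ℂ] ℂ) (a : Fin m → ℂ) :
    eval a (genPoly d φ) = φ (lin a ^ d) := by
  rw [genPoly, lin, Finset.sum_pow_eq_sum_piAntidiag, map_sum, map_sum]
  refine Finset.sum_congr rfl fun k _ => ?_
  have h1 : (Nat.multinomial Finset.univ k : MvPolynomial (Fin m) ℂ) *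
      ∏ i, (C (a i) * X i) ^ k i = ((Nat.multinomial Finset.univ k : ℂ) * ∏ i, a i ^ k i) •
        monomial (Finsupp.equivFunOnFinite.symm k) 1 := by
    rw [smul_eq_C_mul, monomial_eq, Finsupp.prod_fintype _ _ (by simp)]
    simp [mul_pow, Finset.prod_mul_distrib, mul_assoc]
  rw [h1, map_smul, eval_monomial, Finsupp.prod_fintype _ _ (by simp)]
  simp only [Finsupp.equivFunOnFinite_symm_apply_apply, smul_eq_mul]
  ring

theorem apolar_genPoly {m : ℕ} (d : ℕ) (φ : MvPolynomial (Fin m) ℂ →ₗ[ℂ] ℂ)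
    (h : MvPolynomial (Fin m) ℂ) (hhom : h.IsHomogeneous d) :
    apolar h (genPoly d φ) = (d.factorial : ℂ) * φ h := by
  conv_rhs => rw [homog_sum h hhom]
  rw [genPoly, map_sum, map_sum, Finset.mul_sum]
  refine Finset.sum_congr rfl fun k hk => ?_
  have hk' : ∑ i, k i = d := by simpa using hk
  have hm := Nat.multinomial_spec Finset.univ k
  rw [hk'] at hm
  have h1 : monomial (Finsupp.equivFunOnFinite.symm k) (coeff (Finsupp.equivFunOnFinite.symm k) h)
      = coeff (Finsupp.equivFunOnFinite.symm k) h •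
        monomial (Finsupp.equivFunOnFinite.symm k) (1 : ℂ) := by
    simp [smul_monomial]
  rw [h1, map_smul, apolar_monomial, ← hm]
  simp only [Finsupp.equivFunOnFinite_symm_apply_apply, smul_eq_mul]
  push_cast
  ring

/-- Every harmonic homogeneous polynomial of degree `d` lies in the span of
`d`-th powers of isotropic linear forms. -/
theorem stmt1 (n d : ℕ) (hn : 1 ≤ n) (h : MvPolynomial (Fin (n + 1)) ℂ)
    (hharm : lap h = 0) (hhom : h.IsHomogeneous d) :
    h ∈ Submodule.span ℂ
      {p : MvPolynomial (Fin (n + 1)) ℂ |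
        ∃ a : Fin (n + 1) → ℂ, Isotropic a ∧ p = (lin a) ^ d} := by
  by_contra hnot
  obtain ⟨φ, hφ, hker⟩ := Submodule.exists_le_ker_of_notMem hnot
  obtain ⟨f, hf⟩ := quad_dvd n hn (genPoly d φ) (by
    intro a ha
    rw [eval_genPoly]
    exact hker (Submodule.subset_span ⟨a, ha, rfl⟩))
  have h1 := apolar_genPoly d φ h hhom
  rw [hf, apolar_quad, hharm, apolar_zero] at h1
  rcases mul_eq_zero.1 h1.symm with h2 | h2
  · exact Nat.factorial_ne_zero d (by exact_mod_cast h2)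
  · exact hφ h2
end

section
/- Let n ≥ 1, d ≥ 1 and let h ∈ ℂ[x_0,…,x_n] be a nonzero harmonic homogeneous polynomial of degree d. Then rk(h) ≤ irk(h) ≤ 2·rk(h). -/
open MvPolynomial

theorem lin_add' {n : ℕ} (a b : Fin n → ℂ) : lin (a + b) = lin a + lin b := by
  simp [lin, add_mul, Finset.sum_add_distrib]

theorem lin_smul' {n : ℕ} (t : ℂ) (a : Fin n → ℂ) : lin (t • a) = C t * lin a := by
  simp [lin, Finset.mul_sum, mul_assoc]

theorem pderiv_lin {n : ℕ} (i : Fin n) (a : Fin n → ℂ) : pderiv i (lin a) = C (a i) := by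
  simp [lin, pderiv_X, Pi.single_apply]

theorem pderiv_lin_pow {n : ℕ} (i : Fin n) (a : Fin n → ℂ) (m : ℕ) :
    pderiv i (lin a ^ m) = C ((m : ℂ) * a i) * lin a ^ (m - 1) := by
  rw [pderiv_pow, pderiv_lin]
  simp
  ring

theorem lap_lin_pow {n : ℕ} (a : Fin n → ℂ) (m : ℕ) :
    lap (lin a ^ m) = C ((m : ℂ) * ((m - 1 : ℕ) : ℂ) * ∑ i, a i ^ 2) * lin a ^ (m - 2) := by
  simp only [lap, pderiv_lin_pow, pderiv_C_mul]
  rw [Finset.mul_sum, map_sum, Finset.sum_mul]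
  refine Finset.sum_congr rfl fun i _ => ?_
  rw [Nat.sub_sub, ← mul_assoc, ← C_mul]
  congr 2
  ring

theorem lap_sum_lin {n : ℕ} {ι : Type*} [Fintype ι] (c : ι → ℂ) (v : ι → Fin n → ℂ) (m : ℕ) :
    lap (∑ k, C (c k) * lin (v k) ^ m) = C ((m : ℂ) * ((m - 1 : ℕ) : ℂ)) *
      ∑ k, C (c k * ∑ i, v k i ^ 2) * lin (v k) ^ (m - 2) := by
  have : lap (∑ k, C (c k) * lin (v k) ^ m) = ∑ k, C (c k) * lap (lin (v k) ^ m) := by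
    simp only [lap, map_sum, pderiv_C_mul, Finset.mul_sum]
    rw [Finset.sum_comm]
  rw [this, Finset.mul_sum]
  refine Finset.sum_congr rfl fun k _ => ?_
  rw [lap_lin_pow, ← mul_assoc, ← mul_assoc, ← C_mul, ← C_mul]
  congr 2
  ring

/-- directional derivative -/
noncomputable def dirD {n : ℕ} (e : Fin n → ℂ) (p : MvPolynomial (Fin n) ℂ) :
    MvPolynomial (Fin n) ℂ := ∑ i, C (e i) * pderiv i p

theorem dirD_sum {n : ℕ} {ι : Type*} [Fintype ι] (e : Fin n → ℂ)
    (c : ι → ℂ) (v : ι → Fin n → ℂ) (m : ℕ) :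
    dirD e (∑ k, C (c k) * lin (v k) ^ m) = C (m : ℂ) *
      ∑ k, C (c k * ∑ i, v k i * e i) * lin (v k) ^ (m - 1) := by
  simp only [dirD, map_sum, pderiv_C_mul, Finset.mul_sum, pderiv_lin_pow]
  rw [Finset.sum_comm]
  refine Finset.sum_congr rfl fun k _ => ?_
  rw [Finset.sum_mul, Finset.mul_sum]
  refine Finset.sum_congr rfl fun i _ => ?_
  simp only [map_mul]
  ring

theorem dirD_iter {n : ℕ} {ι : Type*} [Fintype ι] (e : Fin n → ℂ)
    (c : ι → ℂ) (v : ι → Fin n → ℂ) (m : ℕ)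
    (h : ∑ k, C (c k) * lin (v k) ^ m = 0) (j : ℕ) (hj : j ≤ m) :
    ∑ k, C (c k * (∑ i, v k i * e i) ^ j) * lin (v k) ^ (m - j) = 0 := by
  induction j with
  | zero => simpa using h
  | succ j ih =>
    have h1 := ih (by omega)
    have h2 := dirD_sum e (fun k => c k * (∑ i, v k i * e i) ^ j) v (m - j)
    rw [h1] at h2
    have h3 : dirD e 0 = 0 := by simp [dirD]
    rw [h3] at h2
    have h4 := (mul_eq_zero.mp h2.symm).resolve_left (by
      simp only [ne_eq, C_eq_zero, Nat.cast_eq_zero]; omega)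
    rw [← h4]
    refine Finset.sum_congr rfl fun k _ => ?_
    rw [Nat.sub_sub, pow_succ, mul_assoc]

/-- projection along `e` of linear forms -/
theorem proj_lin {n : ℕ} (e v : Fin n → ℂ) :
    aeval (fun i => X i - C (e i) * lin e) (lin v) = lin (v - (∑ i, v i * e i) • e) := by
  have : v - (∑ i, v i * e i) • e = v + (-(∑ i, v i * e i)) • e := by
    rw [neg_smul, sub_eq_add_neg]
  rw [this, lin_add', lin_smul']
  have hl : lin v = ∑ i, C (v i) * X i := rfl
  conv_lhs => rw [hl]
  simp only [map_sum, map_mul, aeval_X, aeval_C, algebraMap_eq, mul_sub, Finset.sum_sub_distrib,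
    map_neg, Finset.sum_mul, neg_mul, ← sub_eq_add_neg]
  rw [hl]
  simp only [mul_assoc]

theorem sq_split {n : ℕ} (e v : Fin n → ℂ) (he : ∑ i, e i ^ 2 = 1) (t : ℂ) :
    ∑ i, ((v - (∑ i, v i * e i) • e) + t • e) i ^ 2 = 
      ∑ i, v i ^ 2 - (∑ i, v i * e i) ^ 2 + t ^ 2 := by
  set τ := ∑ i, v i * e i with hτ
  have : ∀ i, ((v - τ • e) + t • e) i ^ 2 =
      v i ^ 2 + 2 * (t - τ) * (v i * e i) + (t - τ) ^ 2 * e i ^ 2 := by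
    intro i; simp; ring
  simp only [this, Finset.sum_add_distrib, ← Finset.mul_sum, he, ← hτ]
  ring

theorem key {n : ℕ} {ι : Type*} [Fintype ι] (e : Fin n → ℂ) (he : ∑ i, e i ^ 2 = 1)
    (c : ι → ℂ) (v : ι → Fin n → ℂ) (d : ℕ)
    (hh : lap (∑ k, C (c k) * lin (v k) ^ d) = 0)
    (h0 : ∑ k, C (c k) * lin (v k - (∑ i, v k i * e i) • e) ^ d = 0)
    (h1 : ∑ k, C (c k * ∑ i, v k i * e i) * lin (v k - (∑ i, v k i * e i) • e) ^ (d - 1) = 0) :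
    ∑ k, C (c k) * lin (v k) ^ d = 0 := by
  have M : ∀ j, j ≤ d → ∑ k, C (c k * (∑ i, v k i * e i) ^ j) *
      lin (v k - (∑ i, v k i * e i) • e) ^ (d - j) = 0 := by
    intro j
    induction j using Nat.strong_induction_on with
    | _ j ih =>
      intro hj
      match j, ih, hj with
      | 0, _, _ => simpa using h0
      | 1, _, _ => simpa using h1
      | j + 2, ih, hj =>
        have a1 := ih j (by omega) (by omega)
        have a2 := lap_sum_lin (fun k => c k * (∑ i, v k i * e i) ^ j)
          (fun k => v k - (∑ i, v k i * e i) • e) (d - j)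
        rw [a1] at a2
        have h3 : lap (0 : MvPolynomial (Fin n) ℂ) = 0 := by simp [lap]
        rw [h3] at a2
        have a3 := (mul_eq_zero.mp a2.symm).resolve_left (by
          simp only [ne_eq, C_eq_zero, mul_eq_zero, Nat.cast_eq_zero]; omega)
        rw [lap_sum_lin] at hh
        have b1 := (mul_eq_zero.mp hh).resolve_left (by
          simp only [ne_eq, C_eq_zero, mul_eq_zero, Nat.cast_eq_zero]; omega)
        have b2 := dirD_iter e _ v (d - 2) b1 j (by omega)
        have b3 := congrArg (aeval (fun i => X i - C (e i) * lin e)) b2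
        simp only [map_sum, map_mul, map_pow, map_zero, aeval_C, algebraMap_eq, proj_lin] at b3
        rw [← sub_zero (0 : MvPolynomial (Fin n) ℂ)]
        nth_rewrite 2 [← a3]
        rw [← b3, ← Finset.sum_sub_distrib]
        refine Finset.sum_congr rfl fun k _ => ?_
        have q := sq_split e (v k) he 0
        simp only [zero_smul, add_zero, ne_eq, OfNat.ofNat_ne_zero, not_false_eq_true,
          zero_pow] at q
        rw [q, show d - (j + 2) = d - j - 2 by omega, show d - 2 - j = d - j - 2 by omega]
        simp only [map_sum, map_mul, map_pow, map_sub]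
        ring
  have E : ∀ k, lin (v k) = C (∑ i, v k i * e i) * lin e +
      lin (v k - (∑ i, v k i * e i) • e) := by
    intro k
    rw [← lin_smul', ← lin_add']
    congr 1
    abel
  have : ∀ k, C (c k) * lin (v k) ^ d = ∑ j ∈ Finset.range (d + 1),
      (lin e ^ j * (d.choose j : MvPolynomial (Fin n) ℂ)) * (C (c k * (∑ i, v k i * e i) ^ j) *
      lin (v k - (∑ i, v k i * e i) • e) ^ (d - j)) := by
    intro k
    rw [E k, add_pow, Finset.mul_sum]
    refine Finset.sum_congr rfl fun j _ => ?_
    rw [mul_pow, map_mul, map_pow]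
    ring
  simp only [this]
  rw [Finset.sum_comm]
  refine Finset.sum_eq_zero fun j hj => ?_
  rw [← Finset.mul_sum, M j (by simpa [Nat.lt_succ_iff] using hj), mul_zero]

theorem exists_e {n r : ℕ} (hn : 1 ≤ n) (ℓ : Fin r → Fin (n + 1) → ℂ) :
    ∃ e : Fin (n + 1) → ℂ, ∑ i, e i ^ 2 = 1 ∧
      ∀ j, ℓ j = 0 ∨ ∑ i, ℓ j i ^ 2 - (∑ i, ℓ j i * e i) ^ 2 ≠ 0 := by
  classical
  obtain ⟨m, rfl⟩ : ∃ m, n = m + 1 := ⟨n - 1, by omega⟩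
  let P : (Fin (m + 1 + 1) → ℂ) → MvPolynomial (Fin (m + 1 + 1)) ℂ := fun a =>
    C (∑ i, a i ^ 2) * (∑ i, X i ^ 2) - (lin a) ^ 2
  have Pev : ∀ a e : Fin (m + 1 + 1) → ℂ, eval e (P a) = (∑ i, a i ^ 2) * (∑ i, e i ^ 2) - (∑ i, a i * e i) ^ 2 := by
    intro a e; simp [P, lin]
  have Pne : ∀ a, a ≠ 0 → P a ≠ 0 := by
    intro a ha hP
    have h1 : ∀ e : Fin (m + 1 + 1) → ℂ, (∑ i, a i ^ 2) * (∑ i, e i ^ 2) - (∑ i, a i * e i) ^ 2 = 0 := by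
      intro e; rw [← Pev, hP, map_zero]
    have h2 : ∀ i, ∑ i, a i ^ 2 = a i ^ 2 := by
      intro i
      have := h1 (Pi.single i 1)
      simp [Pi.single_apply] at this
      linear_combination this
    have h3 := h1 (Pi.single 0 1 + Pi.single 1 1)
    have h4 : ∑ i : Fin (m + 1 + 1), (Pi.single 0 1 + Pi.single 1 1 : Fin (m + 1 + 1) → ℂ) i ^ 2
        = 2 := by
      simp [Pi.single_apply, add_sq, Finset.sum_add_distrib]
      try norm_num
    have h5 : ∑ i, a i * (Pi.single 0 1 + Pi.single 1 1 : Fin (m + 1 + 1) → ℂ) i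
        = a 0 + a 1 := by
      simp [Pi.single_apply, mul_add, Finset.sum_add_distrib]
    rw [h4, h5] at h3
    have h6 : a 0 * a 1 = 0 := by
      linear_combination (-1/2) * h3 + (1/2) * h2 0 + (1/2) * h2 1
    have h7 : ∑ i, a i ^ 2 = 0 := by
      rcases mul_eq_zero.mp h6 with h | h
      · rw [h2 0, h]; simp
      · rw [h2 1, h]; simp
    apply ha
    funext i
    have := h2 i
    rw [h7] at this
    simpa using this.symm
  have Qne : (∑ i, X i ^ 2 : MvPolynomial (Fin (m + 1 + 1)) ℂ) ≠ 0 := by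
    intro h
    have := congrArg (eval (Pi.single (M := fun _ => ℂ) 0 (1 : ℂ))) h
    simp [Pi.single_apply] at this
  have hprod : (∑ i, X i ^ 2 : MvPolynomial (Fin (m + 1 + 1)) ℂ) *
      ∏ j, (if ℓ j = 0 then 1 else P (ℓ j)) ≠ 0 := by
    refine mul_ne_zero Qne (Finset.prod_ne_zero_iff.mpr fun j _ => ?_)
    split_ifs with h
    · exact one_ne_zero
    · exact Pne _ h
  obtain ⟨f, hf⟩ : ∃ f, eval f ((∑ i, X i ^ 2 : MvPolynomial (Fin (m + 1 + 1)) ℂ) *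
      ∏ j, (if ℓ j = 0 then 1 else P (ℓ j))) ≠ 0 := by
    by_contra! hc
    exact hprod (MvPolynomial.funext fun x => by rw [hc, map_zero])
  rw [map_mul, map_prod] at hf
  have hq : ∑ i, f i ^ 2 ≠ 0 := by simpa using left_ne_zero_of_mul hf
  have hp := Finset.prod_ne_zero_iff.mp (right_ne_zero_of_mul hf)
  obtain ⟨s, hs⟩ := IsAlgClosed.exists_pow_nat_eq (∑ i, f i ^ 2) (n := 2) (by norm_num)
  have hs0 : s ≠ 0 := by rintro rfl; apply hq; rw [← hs]; simp
  refine ⟨s⁻¹ • f, ?_, fun j => ?_⟩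
  · simp only [Pi.smul_apply, smul_eq_mul, mul_pow, ← Finset.mul_sum]
    rw [← hs]; field_simp
  · by_cases h : ℓ j = 0
    · exact Or.inl h
    · right
      have := hp j (Finset.mem_univ _)
      rw [if_neg h, Pev, ← hs] at this
      intro h'
      apply this
      have h8 : ∑ i, ℓ j i * (s⁻¹ • f) i = s⁻¹ * ∑ i, ℓ j i * f i := by
        rw [Finset.mul_sum]
        refine Finset.sum_congr rfl fun i _ => ?_
        simp; ring
      rw [h8] at h'
      have h9 : ∑ i, ℓ j i ^ 2 = (s⁻¹ * ∑ i, ℓ j i * f i) ^ 2 := by linear_combination h'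
      rw [h9]
      field_simp
      ring

theorem double {n d r : ℕ} (hn : 1 ≤ n) (hd : 1 ≤ d) (ℓ : Fin r → Fin (n + 1) → ℂ)
    (hharm : lap (∑ j, lin (ℓ j) ^ d) = 0) :
    ∃ w : Fin (2 * r) → Fin (n + 1) → ℂ, (∀ j, Isotropic (w j)) ∧
      ∑ j, lin (ℓ j) ^ d = ∑ j, lin (w j) ^ d := by
  obtain ⟨e, he, hgen⟩ := exists_e hn ℓ
  have hex : ∀ j, ∃ α β t : ℂ, ∑ i, ℓ j i ^ 2 - (∑ i, ℓ j i * e i) ^ 2 + t ^ 2 = 0 ∧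
      α + β = 1 ∧ (α - β) * t = ∑ i, ℓ j i * e i := by
    intro j
    rcases hgen j with h | h
    · exact ⟨1/2, 1/2, 0, by simp [h], by norm_num, by simp [h]⟩
    · set τ := ∑ i, ℓ j i * e i
      obtain ⟨t, ht⟩ := IsAlgClosed.exists_pow_nat_eq
        (-(∑ i, ℓ j i ^ 2 - τ ^ 2)) (n := 2) (by norm_num)
      have ht0 : t ≠ 0 := by
        rintro rfl
        apply h
        linear_combination ht
      refine ⟨(1 + τ / t) / 2, (1 - τ / t) / 2, t, by rw [ht]; ring, by ring, ?_⟩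
      field_simp
      ring
  choose α β t ht hαβ hτ using hex
  let m : Fin r → Fin (n + 1) → ℂ := fun j => ℓ j - (∑ i, ℓ j i * e i) • e
  have he' : ∑ i, e i * e i = 1 := by rw [← he]; simp only [sq]
  have hm : ∀ j, ∑ i, m j i * e i = 0 := by
    intro j
    simp only [m, Pi.sub_apply, Pi.smul_apply, smul_eq_mul, sub_mul, Finset.sum_sub_distrib,
      mul_assoc, ← Finset.mul_sum, he']
    ring
  have hdot : ∀ j s, ∑ i, (m j + s • e) i * e i = s := by
    intro j s
    simp only [Pi.add_apply, Pi.smul_apply, smul_eq_mul, add_mul, Finset.sum_add_distrib,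
      mul_assoc, ← Finset.mul_sum, he', hm]
    ring
  have hiso : ∀ j s, s ^ 2 = t j ^ 2 → Isotropic (m j + s • e) := by
    intro j s hs
    unfold Isotropic
    rw [sq_split e (ℓ j) he s, hs, ht]
  let c : Fin r × Fin 3 → ℂ := fun p => ![1, -α p.1, -β p.1] p.2
  let v : Fin r × Fin 3 → Fin (n + 1) → ℂ := fun p =>
    ![ℓ p.1, m p.1 + t p.1 • e, m p.1 + (-t p.1) • e] p.2
  have hsum : ∑ p, C (c p) * lin (v p) ^ d = ∑ j, lin (ℓ j) ^ d -
      ∑ j, (C (α j) * lin (m j + t j • e) ^ d + C (β j) * lin (m j + (-t j) • e) ^ d) := by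
    rw [Fintype.sum_prod_type, ← Finset.sum_sub_distrib]
    refine Finset.sum_congr rfl fun j _ => ?_
    rw [Fin.sum_univ_three]
    simp [c, v]
    ring
  have hlapsum : lap (∑ p, C (c p) * lin (v p) ^ d) = 0 := by
    rw [lap_sum_lin]
    have h1 := lap_sum_lin (fun _ : Fin r => (1 : ℂ)) ℓ d
    simp only [C_1, one_mul, hharm] at h1
    have h2 : ∑ p, C (c p * ∑ i, v p i ^ 2) * lin (v p) ^ (d - 2) =
        ∑ j, C (∑ i, ℓ j i ^ 2) * lin (ℓ j) ^ (d - 2) := by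
      rw [Fintype.sum_prod_type]
      refine Finset.sum_congr rfl fun j _ => ?_
      have i1 : ∑ i, (m j + t j • e) i ^ 2 = 0 := hiso j (t j) rfl
      have i2 : ∑ i, (m j + (-t j) • e) i ^ 2 = 0 := hiso j (-t j) (by ring)
      rw [Fin.sum_univ_three]
      simp only [c, v, Matrix.cons_val]
      rw [i1, i2]
      simp
    rw [h2, ← h1]
  have hres := key e he c v d hlapsum (by
      rw [Fintype.sum_prod_type]
      refine Finset.sum_eq_zero fun j _ => ?_
      rw [Fin.sum_univ_three]
      simp only [c, v, Matrix.cons_val]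
      rw [hdot, hdot, add_sub_cancel_right, add_sub_cancel_right]
      change C 1 * lin (m j) ^ d + _ + _ = 0
      rw [← hαβ j]
      simp only [map_add, map_neg]
      ring) (by
      rw [Fintype.sum_prod_type]
      refine Finset.sum_eq_zero fun j _ => ?_
      rw [Fin.sum_univ_three]
      simp only [c, v, Matrix.cons_val]
      rw [hdot, hdot, add_sub_cancel_right, add_sub_cancel_right]
      change C (1 * ∑ i, ℓ j i * e i) * lin (m j) ^ (d - 1) + _ + _ = 0
      rw [← hτ j]
      simp only [map_mul, map_sub, map_neg, map_one]
      ring)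
  rw [hsum, sub_eq_zero] at hres
  have hroot : ∀ (a : ℂ) (x : Fin (n + 1) → ℂ), Isotropic x →
      ∃ y, Isotropic y ∧ C a * lin x ^ d = lin y ^ d := by
    intro a x hx
    obtain ⟨b, hb⟩ := IsAlgClosed.exists_pow_nat_eq a (n := d) hd
    refine ⟨b • x, ?_, ?_⟩
    · unfold Isotropic at *
      simp only [Pi.smul_apply, smul_eq_mul, mul_pow, ← Finset.mul_sum, hx, mul_zero]
    · rw [lin_smul', mul_pow, ← hb, map_pow]
  choose y1 hy1 hy1' using fun j => hroot (α j) _ (hiso j (t j) rfl)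
  choose y2 hy2 hy2' using fun j => hroot (β j) _ (hiso j (-t j) (by ring))
  let eq : Fin (2 * r) ≃ Fin 2 × Fin r := finProdFinEquiv.symm
  let W : Fin 2 × Fin r → Fin (n + 1) → ℂ := fun p => ![y1 p.2, y2 p.2] p.1
  refine ⟨fun k => W (eq k), fun k => ?_, ?_⟩
  · change Isotropic (W (eq k))
    rcases eq k with ⟨a, j⟩
    fin_cases a
    · exact hy1 j
    · exact hy2 j
  · rw [hres, Equiv.sum_comp eq (fun p => lin (W p) ^ d), Fintype.sum_prod_type,
      Fin.sum_univ_two, Finset.sum_add_distrib]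
    simp only [hy1', hy2', W, Matrix.cons_val]

/-- For a nonzero harmonic form `h`, `rk h ≤ irk h ≤ 2 · rk h`. -/
theorem stmt2 (n d : ℕ) (hn : 1 ≤ n) (hd : 1 ≤ d)
    (h : MvPolynomial (Fin (n + 1)) ℂ) (h0 : h ≠ 0)
    (hharm : lap h = 0) (hhom : h.IsHomogeneous d) :
    wrk d h ≤ irk d h ∧ irk d h ≤ 2 * wrk d h := by
  by_cases hne : {r : ℕ | ∃ ℓ : Fin r → (Fin (n + 1) → ℂ), h = ∑ j, (lin (ℓ j)) ^ d}.Nonempty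
  · obtain ⟨ℓ, hℓ⟩ := Nat.sInf_mem hne
    obtain ⟨w, hw, hw'⟩ := double hn hd ℓ (hℓ ▸ hharm)
    have hmem : 2 * wrk d h ∈ {r : ℕ | ∃ ℓ : Fin r → (Fin (n + 1) → ℂ),
        (∀ j, Isotropic (ℓ j)) ∧ h = ∑ j, (lin (ℓ j)) ^ d} := ⟨w, hw, hℓ.trans hw'⟩
    refine ⟨?_, Nat.sInf_le hmem⟩
    obtain ⟨u, _, hu⟩ := Nat.sInf_mem ⟨_, hmem⟩
    exact Nat.sInf_le ⟨u, hu⟩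
  · have e1 := Set.not_nonempty_iff_eq_empty.mp hne
    have e2 : {r : ℕ | ∃ ℓ : Fin r → (Fin (n + 1) → ℂ),
        (∀ j, Isotropic (ℓ j)) ∧ h = ∑ j, (lin (ℓ j)) ^ d} = ∅ := by
      apply Set.eq_empty_of_forall_notMem
      rintro r ⟨u, _, hu⟩
      exact hne ⟨r, u, hu⟩
    simp only [wrk, irk, e1, e2]
    simp
end

section
/- Let H ∈ ℂ^{(n+1)×(n+1)} be a symmetric matrix with trace(H) = 0. If H is nilpotent and rank(H²) = 1, then irk(H) = rank(H) + 2. Otherwise, irk(H) = rank(H). -/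
open Matrix

/-- Isotropic rank of a matrix: least `r` such that `H = ∑ vⱼ vⱼᵀ` with each
`vⱼ` isotropic (`vⱼᵀ vⱼ = 0`). -/
noncomputable def irkM {n : ℕ} (H : Matrix (Fin n) (Fin n) ℂ) : ℕ :=
  sInf {r : ℕ | ∃ v : Fin r → (Fin n → ℂ),
    (∀ j, v j ⬝ᵥ v j = 0) ∧ H = ∑ j, vecMulVec (v j) (v j)}



/-- bilinear form of a matrix -/
def bf {N : ℕ} (M : Matrix (Fin N) (Fin N) ℂ) (x y : Fin N → ℂ) : ℂ := x ⬝ᵥ M *ᵥ y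

lemma bf_symm {N : ℕ} {M : Matrix (Fin N) (Fin N) ℂ} (h : M.IsSymm) (x y : Fin N → ℂ) :
    bf M x y = bf M y x := by
  unfold bf
  rw [dotProduct_mulVec, dotProduct_comm, ← mulVec_transpose, h.eq]

lemma bf_add_left {N : ℕ} (M : Matrix (Fin N) (Fin N) ℂ) (x x' y : Fin N → ℂ) :
    bf M (x + x') y = bf M x y + bf M x' y := by simp [bf, add_dotProduct]

lemma bf_add_right {N : ℕ} (M : Matrix (Fin N) (Fin N) ℂ) (x y y' : Fin N → ℂ) :
    bf M x (y + y') = bf M x y + bf M x y' := by simp [bf, mulVec_add]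

lemma bf_sub_left {N : ℕ} (M : Matrix (Fin N) (Fin N) ℂ) (x x' y : Fin N → ℂ) :
    bf M (x - x') y = bf M x y - bf M x' y := by simp [bf, sub_dotProduct]

lemma bf_sub_right {N : ℕ} (M : Matrix (Fin N) (Fin N) ℂ) (x y y' : Fin N → ℂ) :
    bf M x (y - y') = bf M x y - bf M x y' := by simp [bf, mulVec_sub]

lemma bf_smul_left {N : ℕ} (M : Matrix (Fin N) (Fin N) ℂ) (c : ℂ) (x y : Fin N → ℂ) :
    bf M (c • x) y = c * bf M x y := by simp [bf]

lemma bf_smul_right {N : ℕ} (M : Matrix (Fin N) (Fin N) ℂ) (c : ℂ) (x y : Fin N → ℂ) :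
    bf M x (c • y) = c * bf M x y := by simp [bf, mulVec_smul]

lemma bf_sub {N : ℕ} (M M' : Matrix (Fin N) (Fin N) ℂ) (x y : Fin N → ℂ) :
    bf (M - M') x y = bf M x y - bf M' x y := by simp [bf, sub_mulVec]

lemma bf_smul {N : ℕ} (c : ℂ) (M : Matrix (Fin N) (Fin N) ℂ) (x y : Fin N → ℂ) :
    bf (c • M) x y = c * bf M x y := by simp [bf, smul_mulVec]

lemma bf_vecMulVec {N : ℕ} (a b x y : Fin N → ℂ) :
    bf (vecMulVec a b) x y = (x ⬝ᵥ a) * (b ⬝ᵥ y) := by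
  simp [bf, vecMulVec_mulVec, mul_comm]

/-- equality from bilinear values -/
lemma eq_of_bf {N : ℕ} {M M' : Matrix (Fin N) (Fin N) ℂ} (h : ∀ x y, bf M x y = bf M' x y) :
    M = M' := by
  ext i j
  have := h (Pi.single i 1) (Pi.single j 1)
  simpa [bf] using this

lemma bf_polar {N : ℕ} {M : Matrix (Fin N) (Fin N) ℂ} (h : M.IsSymm) (x y : Fin N → ℂ) :
    2 * bf M x y = bf M (x + y) (x + y) - bf M x x - bf M y y := by
  rw [bf_add_left, bf_add_right, bf_add_right, bf_symm h y x]; ring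

lemma eq_of_qf {N : ℕ} {M M' : Matrix (Fin N) (Fin N) ℂ} (h : M.IsSymm) (h' : M'.IsSymm)
    (hq : ∀ x, bf M x x = bf M' x x) : M = M' := by
  apply eq_of_bf
  intro x y
  have h1 := bf_polar h x y
  have h2 := bf_polar h' x y
  simp only [hq] at h1
  rw [← h2] at h1
  exact mul_left_cancel₀ two_ne_zero h1

lemma exists_qf_ne {N : ℕ} {M : Matrix (Fin N) (Fin N) ℂ} (h : M.IsSymm) (h0 : M ≠ 0) :
    ∃ x, bf M x x ≠ 0 := by
  by_contra! hc
  exact h0 (eq_of_qf h (by simp [Matrix.IsSymm]) (fun x => by rw [hc x]; simp [bf]))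

/-! rank facts -/

lemma mrank_add_le {N : ℕ} (A B : Matrix (Fin N) (Fin N) ℂ) :
    (A + B).rank ≤ A.rank + B.rank := by
  unfold Matrix.rank
  rw [Matrix.mulVecLin_add]
  refine (Submodule.finrank_mono (LinearMap.range_add_le _ _)).trans ?_
  exact Submodule.finrank_add_le_finrank_add_finrank _ _

lemma mrank_sum_le {N m : ℕ} (v : Fin m → Matrix (Fin N) (Fin N) ℂ) (h : ∀ j, (v j).rank ≤ 1) :
    (∑ j, v j).rank ≤ m := by
  induction m with
  | zero => simp
  | succ m ih =>
    rw [Fin.sum_univ_succ]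
    have := mrank_add_le (v 0) (∑ j : Fin m, v j.succ)
    have := h 0
    have := ih (fun j => v j.succ) (fun j => h _)
    omega

lemma rank_one_form {N : ℕ} {A : Matrix (Fin N) (Fin N) ℂ} (h : A.rank ≤ 1) :
    ∃ a b, A = vecMulVec a b := by
  unfold Matrix.rank at h
  rw [finrank_le_one_iff] at h
  obtain ⟨⟨a, ha⟩, h⟩ := h
  have : ∀ j, ∃ c : ℂ, c • a = A *ᵥ Pi.single j 1 := by
    intro j
    obtain ⟨c, hc⟩ := h ⟨A *ᵥ Pi.single j 1, ⟨_, rfl⟩⟩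
    exact ⟨c, by simpa using congrArg Subtype.val hc⟩
  choose b hb using this
  refine ⟨a, b, ?_⟩
  ext i j
  have := congrFun (hb j) i
  simp at this
  rw [vecMulVec_apply, ← this, mul_comm]

lemma mrank_eq_zero {N : ℕ} {A : Matrix (Fin N) (Fin N) ℂ} (h : A.rank = 0) : A = 0 := by
  unfold Matrix.rank at h
  rw [Submodule.finrank_eq_zero, LinearMap.range_eq_bot] at h
  ext i j
  have := congrFun (LinearMap.congr_fun h (Pi.single j 1)) i
  simpa using this

lemma trace_idem {N : ℕ} {E : Matrix (Fin N) (Fin N) ℂ} (h : E * E = E) :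
    E.trace = E.rank := by
  have hp : LinearMap.IsProj (LinearMap.range E.mulVecLin) E.mulVecLin := by
    constructor
    · intro x; exact ⟨x, rfl⟩
    · rintro _ ⟨y, rfl⟩
      simp [h]
  have := hp.trace
  rw [Matrix.rank, ← this, ← Matrix.toLin'_apply', Matrix.trace_toLin'_eq]

lemma sq_of_rank_one {N : ℕ} {A : Matrix (Fin N) (Fin N) ℂ} (h : A.rank ≤ 1) :
    A * A = A.trace • A := by
  obtain ⟨a, b, rfl⟩ := rank_one_form h
  rw [vecMulVec_mul_vecMulVec, trace_vecMulVec, dotProduct_comm b a, vecMulVec_smul]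

lemma T1 {N : ℕ} {H : Matrix (Fin N) (Fin N) ℂ} (htr : H.trace = 0) (a : ℂ)
    (h : H = a • (H * H)) : H = 0 := by
  have hE : (a • H) * (a • H) = a • H := by
    conv_rhs => rw [h]
    simp [smul_smul]
  have := trace_idem hE
  simp only [trace_smul, htr, smul_zero] at this
  have h0 := mrank_eq_zero (by exact_mod_cast this.symm)
  rw [h, ← smul_mul_assoc, h0, zero_mul]

lemma T2 {N : ℕ} {H : Matrix (Fin N) (Fin N) ℂ} (htr : H.trace = 0) (a : ℂ)
    (h : H * H = a • H) : H * H = 0 := by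
  by_cases ha : a = 0
  · simp [h, ha]
  · have : H = a⁻¹ • (H * H) := by rw [h, smul_smul, inv_mul_cancel₀ ha, one_smul]
    rw [T1 htr _ this]; simp

lemma T3 {N : ℕ} {H : Matrix (Fin N) (Fin N) ℂ} (htr : H.trace = 0) (a t : ℂ)
    (ht : (H * H).trace = 2 * t) (hr : H.rank ≠ 2)
    (h : H * H * H - t • H = a • (H * H)) : H * H * H = 0 := by
  by_cases ht0 : t = 0
  · subst ht0
    simp at h ht
    by_cases ha : a = 0
    · simpa [ha] using h
    · have h4 : H * H * (H * H) = a ^ 2 • (H * H) := by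
        rw [← mul_assoc, h, smul_mul_assoc, h, smul_smul, sq]
      have := T1 (H := H * H) ht ((a ^ 2)⁻¹) (by
        rw [h4, smul_smul, inv_mul_cancel₀ (pow_ne_zero 2 ha), one_smul])
      rw [this, zero_mul]
  · exfalso
    set E := t⁻¹ • (H * H - a • H) with hE
    have hEE : E = H * (t⁻¹ • (H - a • 1)) := by
      simp [hE, mul_sub]
    have hHE : H * E = H := by
      have h' : H * H * H - a • (H * H) = t • H := by rw [← h]; abel
      rw [hE, mul_smul_comm, mul_sub, ← mul_assoc, mul_smul_comm, h', smul_smul,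
        inv_mul_cancel₀ ht0, one_smul]
    have hid : E * E = E := by
      conv_lhs => rw [hE]
      rw [smul_mul_assoc, sub_mul, mul_assoc, hHE, smul_mul_assoc, hHE]
    have h1 := trace_idem hid
    have h2 : E.trace = 2 := by
      rw [hE]; simp [htr, ht]; field_simp
    have h3 : E.rank ≤ H.rank := by rw [hEE]; exact rank_mul_le_left _ _
    have h4 : H.rank ≤ E.rank := by
      conv_lhs => rw [← hHE]
      exact rank_mul_le_right _ _
    rw [h2] at h1
    have : E.rank = 2 := by exact_mod_cast h1.symm
    omega

lemma T4 {N : ℕ} {H : Matrix (Fin N) (Fin N) ℂ} (htr : H.trace = 0)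
    (h : (H * H).rank = 1) : H * H * H = 0 := by
  obtain ⟨a, b, hab⟩ := rank_one_form h.le
  have hb : ∃ j, b j ≠ 0 := by
    by_contra! hb
    have : H * H = 0 := by rw [hab]; ext i j; simp [vecMulVec_apply, hb]
    simp [this] at h
  obtain ⟨j, hj⟩ := hb
  have hcomm : H * (H * H) = (H * H) * H := by rw [mul_assoc]
  obtain ⟨l, hl⟩ : ∃ l : ℂ, H * H * H = l • (H * H) := by
    refine ⟨(b ᵥ* H) j / b j, ?_⟩
    have hc := hcomm
    rw [hab, mul_vecMulVec, vecMulVec_mul] at hc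
    rw [mul_assoc, hab, mul_vecMulVec]
    ext i k
    have := congrFun (congrFun hc i) j
    simp only [vecMulVec_apply, Matrix.smul_apply, smul_eq_mul] at this ⊢
    field_simp
    linear_combination b k * this
  by_cases hl0 : l = 0
  · simpa [hl0] using hl
  exfalso
  have h4 : H * H * (H * H) = l ^ 2 • (H * H) := by
    rw [← mul_assoc, hl, smul_mul_assoc, hl, smul_smul, sq]
  have hN : (H - l⁻¹ • (H * H)) * (H - l⁻¹ • (H * H)) = 0 := by
    rw [sub_mul, mul_sub, mul_sub, mul_smul_comm, smul_mul_assoc, smul_mul_assoc, mul_smul_comm,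
      hcomm, hl, h4, smul_smul, smul_smul, smul_smul, inv_mul_cancel₀ hl0]
    have : l⁻¹ * l⁻¹ * l ^ 2 = 1 := by field_simp
    rw [this]; simp
  have hn : IsNilpotent (H - l⁻¹ • (H * H)) := ⟨2, by rw [sq, hN]⟩
  have h0 := (Matrix.isNilpotent_trace_of_isNilpotent hn).eq_zero
  have hE := trace_idem (E := (l^2)⁻¹ • (H * H)) (by
    rw [smul_mul_assoc, mul_smul_comm, h4, smul_smul ((l^2)⁻¹) (l^2), inv_mul_cancel₀ (pow_ne_zero 2 hl0), one_smul])
  simp [htr, hl0] at h0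
  rw [trace_smul, h0, smul_zero] at hE
  have hz := mrank_eq_zero (by exact_mod_cast hE.symm)
  have : H * H = 0 := by simpa [hl0] using hz
  simp [this] at h

/-! polynomial functions -/

/-- polynomial functions of two vectors -/
def IsPolyFn {N : ℕ} (f : (Fin N → ℂ) → (Fin N → ℂ) → ℂ) : Prop :=
  ∃ p : MvPolynomial (Fin N ⊕ Fin N) ℂ, ∀ x y, f x y = MvPolynomial.eval (Sum.elim x y) p

lemma IsPolyFn.add {N : ℕ} {f g : (Fin N → ℂ) → (Fin N → ℂ) → ℂ} (hf : IsPolyFn f) (hg : IsPolyFn g) :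
    IsPolyFn (fun x y => f x y + g x y) := by
  obtain ⟨p, hp⟩ := hf; obtain ⟨q, hq⟩ := hg
  exact ⟨p + q, fun x y => by simp [hp, hq]⟩

lemma IsPolyFn.sub {N : ℕ} {f g : (Fin N → ℂ) → (Fin N → ℂ) → ℂ} (hf : IsPolyFn f) (hg : IsPolyFn g) :
    IsPolyFn (fun x y => f x y - g x y) := by
  obtain ⟨p, hp⟩ := hf; obtain ⟨q, hq⟩ := hg
  exact ⟨p - q, fun x y => by simp [hp, hq]⟩

lemma IsPolyFn.mul {N : ℕ} {f g : (Fin N → ℂ) → (Fin N → ℂ) → ℂ} (hf : IsPolyFn f) (hg : IsPolyFn g) :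
    IsPolyFn (fun x y => f x y * g x y) := by
  obtain ⟨p, hp⟩ := hf; obtain ⟨q, hq⟩ := hg
  exact ⟨p * q, fun x y => by simp [hp, hq]⟩

lemma IsPolyFn.const {N : ℕ} (c : ℂ) : IsPolyFn (fun (_ _ : Fin N → ℂ) => c) :=
  ⟨MvPolynomial.C c, fun x y => by simp⟩

lemma bf_eq_sum {N : ℕ} (M : Matrix (Fin N) (Fin N) ℂ) (x y : Fin N → ℂ) :
    bf M x y = ∑ i, x i * ∑ j, M i j * y j := rfl

lemma IsPolyFn.bfxx {N : ℕ} (M : Matrix (Fin N) (Fin N) ℂ) : IsPolyFn (fun x _ => bf M x x) :=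
  ⟨∑ i, MvPolynomial.X (Sum.inl i) * ∑ j, MvPolynomial.C (M i j) * MvPolynomial.X (Sum.inl j),
    fun x y => by simp [bf_eq_sum]⟩

lemma IsPolyFn.bfxy {N : ℕ} (M : Matrix (Fin N) (Fin N) ℂ) : IsPolyFn (fun x y => bf M x y) :=
  ⟨∑ i, MvPolynomial.X (Sum.inl i) * ∑ j, MvPolynomial.C (M i j) * MvPolynomial.X (Sum.inr j),
    fun x y => by simp [bf_eq_sum]⟩

lemma IsPolyFn.bfyy {N : ℕ} (M : Matrix (Fin N) (Fin N) ℂ) :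
    IsPolyFn (fun (_ y : Fin N → ℂ) => bf M y y) :=
  ⟨∑ i, MvPolynomial.X (Sum.inr i) * ∑ j, MvPolynomial.C (M i j) * MvPolynomial.X (Sum.inr j),
    fun x y => by simp [bf_eq_sum]⟩

lemma IsPolyFn.prod_ne {N : ℕ} {f g : (Fin N → ℂ) → (Fin N → ℂ) → ℂ} (hf : IsPolyFn f) (hg : IsPolyFn g)
    (h1 : ∃ x y, f x y ≠ 0) (h2 : ∃ x y, g x y ≠ 0) : ∃ x y, f x y * g x y ≠ 0 := by
  obtain ⟨p, hp⟩ := hf; obtain ⟨q, hq⟩ := hg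
  obtain ⟨x, y, hxy⟩ := h1
  obtain ⟨x', y', hxy'⟩ := h2
  have hp0 : p ≠ 0 := by rintro rfl; simp [hp] at hxy
  have hq0 : q ≠ 0 := by rintro rfl; simp [hq] at hxy'
  by_contra! hc
  apply mul_ne_zero hp0 hq0
  apply MvPolynomial.funext
  intro z
  have := hc (z ∘ Sum.inl) (z ∘ Sum.inr)
  rw [hp, hq, Sum.elim_comp_inl_inr] at this
  simpa using this

/-- discriminant -/
lemma exists_disc {N : ℕ} {G : Matrix (Fin N) (Fin N) ℂ} (hG : G.IsSymm) (hr : 2 ≤ G.rank) :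
    ∃ x y, bf G x y * bf G x y - bf G x x * bf G y y ≠ 0 := by
  have h0 : G ≠ 0 := by rintro rfl; simp at hr
  obtain ⟨x, hx⟩ := exists_qf_ne hG h0
  by_contra! hc
  have : G = vecMulVec ((bf G x x)⁻¹ • (G *ᵥ x)) (G *ᵥ x) := by
    apply eq_of_qf hG
    · rw [Matrix.IsSymm, transpose_vecMulVec, smul_vecMulVec, vecMulVec_smul]
    · intro y
      have h1 := hc x y
      rw [bf_vecMulVec, dotProduct_smul, dotProduct_comm (G *ᵥ x) y]
      change _ = (bf G x x)⁻¹ • bf G y x * bf G y x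
      rw [bf_symm hG y x, smul_eq_mul]
      field_simp
      linear_combination -h1
  have h1 := rank_vecMulVec_le ((bf G x x)⁻¹ • (G *ᵥ x)) (G *ᵥ x)
  rw [← this] at h1
  omega

lemma exists_minor {N : ℕ} {G F : Matrix (Fin N) (Fin N) ℂ} (hG : G.IsSymm) (hF : F.IsSymm)
    (h0 : G ≠ 0) (hF' : ∀ a : ℂ, F ≠ a • G) :
    ∃ x y, bf F x x * bf G y y - bf F y y * bf G x x ≠ 0 := by
  obtain ⟨x, hx⟩ := exists_qf_ne hG h0
  by_contra! hc
  apply hF' (bf F x x / bf G x x)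
  apply eq_of_qf hF (hG.smul _)
  intro y
  rw [bf_smul]
  field_simp
  linear_combination - hc x y

lemma key_s6 {N : ℕ} {G F : Matrix (Fin N) (Fin N) ℂ} (hG : G.IsSymm) (hF : F.IsSymm)
    (hr : 2 ≤ G.rank) (hF' : ∀ a : ℂ, F ≠ a • G)
    {f : (Fin N → ℂ) → (Fin N → ℂ) → ℂ} (hf : IsPolyFn f) (hf0 : ∃ x y, f x y ≠ 0) :
    ∃ x y, ∃ s : ℂ, f x y ≠ 0 ∧ bf G x x ≠ 0 ∧
      bf G (s • x + bf G x x • y) (s • x + bf G x x • y) = 0 ∧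
      bf F (s • x + bf G x x • y) (s • x + bf G x x • y) ≠ 0 := by
  have h0 : G ≠ 0 := by rintro rfl; simp at hr
  have pD := ((IsPolyFn.bfxy G).mul (IsPolyFn.bfxy G)).sub ((IsPolyFn.bfxx G).mul (IsPolyFn.bfyy G))
  have pM := ((IsPolyFn.bfxx F).mul (IsPolyFn.bfyy G)).sub ((IsPolyFn.bfyy F).mul (IsPolyFn.bfxx G))
  obtain ⟨x, hx⟩ := exists_qf_ne hG h0
  have h1 := IsPolyFn.prod_ne hf (IsPolyFn.bfxx G) hf0 ⟨x, x, hx⟩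
  have h2 := IsPolyFn.prod_ne pD pM (exists_disc hG hr) (exists_minor hG hF h0 hF')
  obtain ⟨x, y, hxy⟩ := IsPolyFn.prod_ne (hf.mul (IsPolyFn.bfxx G)) (pD.mul pM) h1 h2
  simp only [mul_ne_zero_iff] at hxy
  obtain ⟨⟨hfx, hA⟩, hD, hM⟩ := hxy
  obtain ⟨d, hd⟩ := IsAlgClosed.exists_pow_nat_eq
    (bf G x y * bf G x y - bf G x x * bf G y y) (n := 2) two_pos
  have hd0 : d ≠ 0 := by rintro rfl; apply hD; rw [← hd]; simp
  have expand : ∀ (M : Matrix (Fin N) (Fin N) ℂ), M.IsSymm → ∀ s t : ℂ,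
      bf M (s • x + t • y) (s • x + t • y) =
        s ^ 2 * bf M x x + 2 * s * t * bf M x y + t ^ 2 * bf M y y := by
    intro M hM s t
    simp only [bf_add_left, bf_add_right, bf_smul_left, bf_smul_right, bf_symm hM y x]; ring
  by_contra! hc
  have z : ∀ e : ℂ, e ^ 2 = bf G x y * bf G x y - bf G x x * bf G y y →
      bf F ((-bf G x y + e) • x + bf G x x • y) ((-bf G x y + e) • x + bf G x x • y) = 0 := by
    intro e he
    refine hc x y _ hfx hA ?_
    rw [expand G hG]
    linear_combination (bf G x x) * he
  have z1 := z d hd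
  have z2 := z (-d) (by rw [neg_sq, hd])
  rw [expand F hF] at z1 z2
  set A := bf G x x
  set B := bf G x y
  set C := bf G y y
  have e1 : A * bf F x y = B * bf F x x := by
    have : d * (A * bf F x y - B * bf F x x) = 0 := by linear_combination (z1 - z2) / 4
    rcases mul_eq_zero.1 this with h | h
    · exact absurd h hd0
    · linear_combination h
  apply hM
  have : A * (bf F x x * C - bf F y y * A) = 0 := by
    linear_combination -z1 + 2 * (-B + d) * e1 + (bf F x x) * hd
  exact (mul_eq_zero.1 this).resolve_left hA

lemma key0 {N : ℕ} {G F : Matrix (Fin N) (Fin N) ℂ} (hG : G.IsSymm) (hF : F.IsSymm)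
    (hr : 2 ≤ G.rank) (hF' : ∀ a : ℂ, F ≠ a • G) : ∃ u, bf G u u = 0 ∧ bf F u u ≠ 0 := by
  obtain ⟨x, y, s, -, -, h1, h2⟩ := key_s6 hG hF hr hF' (IsPolyFn.const 1) ⟨0, 0, one_ne_zero⟩
  exact ⟨_, h1, h2⟩

/-- resultant -/
def res {N : ℕ} (S G : Matrix (Fin N) (Fin N) ℂ) (x y : Fin N → ℂ) : ℂ :=
  (bf S x x * bf G y y - bf S y y * bf G x x) * (bf S x x * bf G y y - bf S y y * bf G x x) -
  4 * ((bf S x x * bf G x y - bf S x y * bf G x x) * (bf S x y * bf G y y - bf S y y * bf G x y))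

lemma IsPolyFn.res {N : ℕ} (S G : Matrix (Fin N) (Fin N) ℂ) : IsPolyFn (res S G) := by
  have h1 := ((bfxx S).mul (bfyy G)).sub ((bfyy S).mul (bfxx G))
  have h2 := ((bfxx S).mul (bfxy G)).sub ((bfxy S).mul (bfxx G))
  have h3 := ((bfxy S).mul (bfyy G)).sub ((bfyy S).mul (bfxy G))
  exact (h1.mul h1).sub ((IsPolyFn.const 4).mul (h2.mul h3))

lemma key1 {N : ℕ} {S G F : Matrix (Fin N) (Fin N) ℂ} (hS : S.IsSymm) (hG : G.IsSymm)
    (hF : F.IsSymm) (hr : 2 ≤ G.rank) (hF' : ∀ a : ℂ, F ≠ a • G) (hR : ∃ x y, res S G x y ≠ 0) :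
    ∃ u, bf G u u = 0 ∧ bf S u u ≠ 0 ∧ bf F u u ≠ 0 := by
  obtain ⟨x, y, s, h0, hA, h1, h2⟩ := key_s6 hG hF hr hF' (IsPolyFn.res S G) hR
  refine ⟨_, h1, ?_, h2⟩
  intro h3
  apply h0
  simp only [bf_add_left, bf_add_right, bf_smul_left, bf_smul_right, bf_symm hS y x,
    bf_symm hG y x] at h1 h3
  unfold res
  set A := bf G x x
  set B := bf G x y
  set C := bf G y y
  set a := bf S x x
  set b := bf S x y
  set c := bf S y y
  have e1 : 2 * (a * B - b * A) * s + (a * C - c * A) * A = 0 := by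
    have : A * (2 * (a * B - b * A) * s + (a * C - c * A) * A) = 0 := by
      linear_combination a * h1 - A * h3
    exact (mul_eq_zero.1 this).resolve_left hA
  have e2 : (a * C - c * A) * s + 2 * (b * C - c * B) * A = 0 := by
    have : A * ((a * C - c * A) * s + 2 * (b * C - c * B) * A) = 0 := by
      linear_combination s * e1 + 2 * (b * h1 - B * h3)
    exact (mul_eq_zero.1 this).resolve_left hA
  have : A * ((a * C - c * A) * (a * C - c * A) -
      4 * ((a * B - b * A) * (b * C - c * B))) = 0 := by
    linear_combination (a * C - c * A) * e1 - 2 * (a * B - b * A) * e2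
  exact (mul_eq_zero.1 this).resolve_left hA

lemma mulself_symm {N : ℕ} {H : Matrix (Fin N) (Fin N) ℂ} (hs : H.IsSymm) : (H * H).IsSymm := by
  rw [Matrix.IsSymm, transpose_mul, hs.eq]

lemma mul3_symm {N : ℕ} {H : Matrix (Fin N) (Fin N) ℂ} (hs : H.IsSymm) : (H * H * H).IsSymm := by
  rw [Matrix.IsSymm, transpose_mul, transpose_mul, hs.eq, mul_assoc]

lemma vecMul_symm {N : ℕ} {H : Matrix (Fin N) (Fin N) ℂ} (hs : H.IsSymm) (x : Fin N → ℂ) :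
    x ᵥ* H = H *ᵥ x := by
  rw [← mulVec_transpose, hs.eq]

lemma dot_mulVec_symm {N : ℕ} {H : Matrix (Fin N) (Fin N) ℂ} (hs : H.IsSymm) (x y : Fin N → ℂ) :
    (H *ᵥ x) ⬝ᵥ y = bf H x y := by
  rw [bf, dotProduct_mulVec, vecMul_symm hs]

lemma exists_res {N : ℕ} {H : Matrix (Fin N) (Fin N) ℂ} (hs : H.IsSymm) (htr : H.trace = 0)
    (h2 : H * H ≠ 0) (hr : 3 ≤ H.rank) : ∃ x y, res H (H * H) x y ≠ 0 := by
  obtain ⟨x, hx, hx2⟩ := key0 hs (mulself_symm hs) (by omega)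
    (fun a ha => h2 (T2 htr a ha))
  have hh : H *ᵥ x ≠ 0 := by
    intro h
    apply hx2
    rw [bf, ← mulVec_mulVec, h]; simp
  obtain ⟨i, hi⟩ := Function.ne_iff.1 hh
  obtain ⟨p', hp'⟩ : ∃ p', bf H x p' = 1 :=
    ⟨Pi.single i ((H *ᵥ x) i)⁻¹, by rw [← dot_mulVec_symm hs]; simpa using mul_inv_cancel₀ hi⟩
  obtain ⟨p, hp, hpp⟩ : ∃ p, bf H x p = 0 ∧ bf H p p ≠ 0 := by
    by_contra! hc
    set k := H *ᵥ p' - (bf H p' p' / 2) • (H *ᵥ x) with hk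
    have : H = vecMulVec (H *ᵥ x) k + vecMulVec k (H *ᵥ x) := by
      apply eq_of_qf hs
      · rw [Matrix.IsSymm, transpose_add, transpose_vecMulVec, transpose_vecMulVec, add_comm]
      · intro p
        have h1 := hc (p - bf H x p • p') (by
          rw [bf_sub_right, bf_smul_right, hp']; ring)
        simp only [bf_sub_left, bf_sub_right, bf_smul_left, bf_smul_right] at h1
        have h3 : bf (vecMulVec (H *ᵥ x) k + vecMulVec k (H *ᵥ x)) p p =
          bf (vecMulVec (H *ᵥ x) k) p p + bf (vecMulVec k (H *ᵥ x)) p p := by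
          simp [bf, add_mulVec]
        rw [h3, bf_vecMulVec, bf_vecMulVec, dotProduct_comm p (H *ᵥ x), dotProduct_comm p k, hk,
          sub_dotProduct, smul_dotProduct, dot_mulVec_symm hs, dot_mulVec_symm hs, smul_eq_mul]
        rw [bf_symm hs p p'] at h1
        linear_combination h1
    have h3 := mrank_add_le (vecMulVec (H *ᵥ x) k) (vecMulVec k (H *ᵥ x))
    rw [← this] at h3
    have := rank_vecMulVec_le (H *ᵥ x) k
    have := rank_vecMulVec_le k (H *ᵥ x)
    omega
  refine ⟨x, p, ?_⟩
  simp [res, hx, hp, hpp, hx2]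

/-- deflation -/
def defl {N : ℕ} (H : Matrix (Fin N) (Fin N) ℂ) (v : Fin N → ℂ) : Matrix (Fin N) (Fin N) ℂ :=
  H - vecMulVec v v

lemma defl_symm {N : ℕ} {H : Matrix (Fin N) (Fin N) ℂ} (hs : H.IsSymm) (v : Fin N → ℂ) :
    (defl H v).IsSymm := by
  rw [defl, Matrix.IsSymm, transpose_sub, hs.eq, transpose_vecMulVec]

lemma defl_trace {N : ℕ} {H : Matrix (Fin N) (Fin N) ℂ} (htr : H.trace = 0) {v : Fin N → ℂ}
    (hv : v ⬝ᵥ v = 0) : (defl H v).trace = 0 := by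
  rw [defl, trace_sub, htr, trace_vecMulVec, hv, sub_zero]

lemma defl_sq {N : ℕ} {H : Matrix (Fin N) (Fin N) ℂ} (hs : H.IsSymm) {v : Fin N → ℂ}
    (hv : v ⬝ᵥ v = 0) : defl H v * defl H v =
      H * H - vecMulVec (H *ᵥ v) v - vecMulVec v (H *ᵥ v) := by
  rw [defl, sub_mul, mul_sub, mul_sub, mul_vecMulVec, vecMulVec_mul, vecMulVec_mul_vecMulVec, hv,
    zero_smul, vecMul_symm hs]
  have : vecMulVec v (0 : Fin N → ℂ) = 0 := by ext; simp [vecMulVec_apply]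
  rw [this, sub_zero]

lemma defl_sq_trace {N : ℕ} {H : Matrix (Fin N) (Fin N) ℂ} (hs : H.IsSymm) {v : Fin N → ℂ}
    (hv : v ⬝ᵥ v = 0) : (defl H v * defl H v).trace = (H * H).trace - 2 * bf H v v := by
  rw [defl_sq hs hv, trace_sub, trace_sub, trace_vecMulVec, trace_vecMulVec,
    dotProduct_comm (H *ᵥ v) v]
  change _ - bf H v v - bf H v v = _
  ring

lemma rank_sq_ne_one {N : ℕ} {H : Matrix (Fin N) (Fin N) ℂ} (htr : H.trace = 0)
    (h : (H * H).trace ≠ 0) : (H * H).rank ≠ 1 := by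
  intro hr
  have h3 := T4 htr hr
  have hn : IsNilpotent (H * H) := ⟨2, by rw [sq, ← mul_assoc, h3, zero_mul]⟩
  exact h (Matrix.isNilpotent_trace_of_isNilpotent hn).eq_zero

lemma defl_rank_lt {N : ℕ} {H : Matrix (Fin N) (Fin N) ℂ} (hs : H.IsSymm) {u : Fin N → ℂ}
    (hu : bf H u u = 1) : (defl H (H *ᵥ u)).rank < H.rank := by
  have h1 := LinearMap.finrank_range_add_finrank_ker H.mulVecLin
  have h2 := LinearMap.finrank_range_add_finrank_ker (defl H (H *ᵥ u)).mulVecLin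
  have hval : ∀ x, defl H (H *ᵥ u) *ᵥ x = H *ᵥ x - bf H u x • (H *ᵥ u) := by
    intro x
    rw [defl, sub_mulVec, vecMulVec_mulVec, dot_mulVec_symm hs]
    simp
  have h3 : LinearMap.ker H.mulVecLin < LinearMap.ker (defl H (H *ᵥ u)).mulVecLin := by
    rw [SetLike.lt_iff_le_and_exists]
    constructor
    · intro x hx
      rw [LinearMap.mem_ker, mulVecLin_apply] at hx ⊢
      rw [hval, hx, bf, hx]; simp
    · refine ⟨u, ?_, ?_⟩
      · rw [LinearMap.mem_ker, mulVecLin_apply, hval, hu]; simp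
      · intro hx
        rw [LinearMap.mem_ker, mulVecLin_apply] at hx
        rw [bf, hx] at hu; simp at hu
  have h4 := Submodule.finrank_lt_finrank_of_lt h3
  unfold Matrix.rank
  omega

lemma bf_normalize {N : ℕ} {H : Matrix (Fin N) (Fin N) ℂ} {u : Fin N → ℂ} (hu : bf H u u ≠ 0) :
    ∃ c : ℂ, c ≠ 0 ∧ bf H (c • u) (c • u) = 1 := by
  obtain ⟨d, hd⟩ := IsAlgClosed.exists_pow_nat_eq (bf H u u) (n := 2) two_pos
  have hd0 : d ≠ 0 := by rintro rfl; apply hu; rw [← hd]; simp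
  refine ⟨d⁻¹, inv_ne_zero hd0, ?_⟩
  rw [bf_smul_left, bf_smul_right, ← hd]; field_simp

lemma dot_self {N : ℕ} {H : Matrix (Fin N) (Fin N) ℂ} (hs : H.IsSymm) (u : Fin N → ℂ) :
    (H *ᵥ u) ⬝ᵥ (H *ᵥ u) = bf (H * H) u u := by
  rw [dot_mulVec_symm hs, bf, bf, mulVec_mulVec]

lemma bf3 {N : ℕ} {H : Matrix (Fin N) (Fin N) ℂ} (hs : H.IsSymm) (u : Fin N → ℂ) :
    bf H (H *ᵥ u) (H *ᵥ u) = bf (H * H * H) u u := by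
  rw [bf, dot_mulVec_symm hs, bf, bf, mulVec_mulVec, mulVec_mulVec]

lemma step {N : ℕ} {H : Matrix (Fin N) (Fin N) ℂ} (hs : H.IsSymm) (htr : H.trace = 0)
    (h2 : (H * H).rank ≠ 1) (h0 : H ≠ 0) :
    ∃ u, bf H u u = 1 ∧ bf (H * H) u u = 0 ∧
      (defl H (H *ᵥ u) * defl H (H *ᵥ u)).rank ≠ 1 := by
  by_cases hK : H * H = 0
  · obtain ⟨u, hu⟩ := exists_qf_ne hs h0
    obtain ⟨c, hc, hu⟩ := bf_normalize hu
    have hz : bf (H * H) (c • u) (c • u) = 0 := by rw [hK]; simp [bf]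
    refine ⟨_, hu, hz, ?_⟩
    rw [defl_sq hs (by rw [dot_self hs, hz]), mulVec_mulVec, hK]
    have e1 : vecMulVec (0 : Fin N → ℂ) (H *ᵥ (c • u)) = 0 := by ext; simp [vecMulVec_apply]
    have e2 : vecMulVec (H *ᵥ (c • u)) (0 : Fin N → ℂ) = 0 := by ext; simp [vecMulVec_apply]
    rw [zero_mulVec, e1, e2]; simp
  have hr2 : 2 ≤ (H * H).rank := by
    have : (H * H).rank ≠ 0 := fun h => hK (mrank_eq_zero h)
    omega
  have hrr : (H * H).rank ≤ H.rank := rank_mul_le_left _ _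
  by_cases hB : H.rank = 2 ∨ H * H * H = 0
  · obtain ⟨u, hz, hu⟩ := key0 (mulself_symm hs) hs hr2 (fun a ha => h0 (T1 htr a ha))
    obtain ⟨c, hc, hu⟩ := bf_normalize hu
    have hz : bf (H * H) (c • u) (c • u) = 0 := by rw [bf_smul_left, bf_smul_right, hz]; simp
    generalize c • u = u at hu hz
    have hv : (H *ᵥ u) ⬝ᵥ (H *ᵥ u) = 0 := by rw [dot_self hs, hz]
    refine ⟨u, hu, hz, ?_⟩
    rcases hB with hB | hB
    · have h1 := defl_rank_lt hs hu
      rw [sq_of_rank_one (by omega), defl_trace htr hv]; simp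
    · intro hD
      have hsq := defl_sq hs hv
      have hDs := mulself_symm (defl_symm hs (H *ᵥ u))
      set D := defl H (H *ᵥ u) * defl H (H *ᵥ u)
      set k := H *ᵥ (H *ᵥ u) with hk
      have hHk : H *ᵥ k = 0 := by
        rw [hk, mulVec_mulVec, mulVec_mulVec, hB, zero_mulVec]
      have z1 : ∀ w : Fin N → ℂ, vecMulVec (0 : Fin N → ℂ) w = 0 := by
        intro w; ext; simp [vecMulVec_apply]
      have z2 : ∀ w : Fin N → ℂ, vecMulVec w (0 : Fin N → ℂ) = 0 := by
        intro w; ext; simp [vecMulVec_apply]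
      have hHD : H * D = - vecMulVec k k := by
        rw [hsq, mul_sub, mul_sub, ← mul_assoc, hB, mul_vecMulVec, mul_vecMulVec, hHk, ← hk, z1]
        simp
      have hDH : D * H = - vecMulVec k k := by
        have := congrArg transpose hHD
        rwa [transpose_mul, hs.eq, hDs.eq, transpose_neg, transpose_vecMulVec] at this
      have hHDH : H * D * H = 0 := by
        rw [hHD, neg_mul, vecMulVec_mul, vecMul_symm hs, hHk, z2, neg_zero]
      obtain ⟨a, b, hab⟩ := rank_one_form hD.le
      rw [hab, mul_vecMulVec, vecMulVec_mul] at hHDH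
      have hkk : vecMulVec k k = 0 := by
        rcases vecMulVec_eq_zero.1 hHDH with h | h
        · rw [hab, mul_vecMulVec, h, z1] at hHD
          simpa using hHD.symm
        · rw [hab, vecMulVec_mul, h, z2] at hDH
          simpa using hDH.symm
      have hk0 : k = 0 := by simpa using hkk
      rw [hk0, z1, z2] at hsq
      rw [hsq] at hD
      simp at hD
      omega
  · push Not at hB
    obtain ⟨hB1, hB2⟩ := hB
    set t := (H * H).trace / 2 with ht
    obtain ⟨u, hz, hu, hF⟩ := key1 (F := H * H * H - t • H) hs (mulself_symm hs)
      ((mul3_symm hs).sub (hs.smul t)) hr2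
      (fun a ha => hB2 (T3 htr a t (by rw [ht]; ring) hB1 ha))
      (exists_res hs htr hK (by omega))
    obtain ⟨c, hc, hu⟩ := bf_normalize hu
    have hz : bf (H * H) (c • u) (c • u) = 0 := by rw [bf_smul_left, bf_smul_right, hz]; simp
    have hF : bf (H * H * H - t • H) (c • u) (c • u) ≠ 0 := by
      rw [bf_smul_left, bf_smul_right]
      exact mul_ne_zero hc (mul_ne_zero hc hF)
    generalize c • u = u at hu hz hF
    have hv : (H *ᵥ u) ⬝ᵥ (H *ᵥ u) = 0 := by rw [dot_self hs, hz]
    refine ⟨u, hu, hz, rank_sq_ne_one (defl_trace htr hv) ?_⟩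
    rw [defl_sq_trace hs hv, bf3 hs]
    rw [bf_sub, bf_smul, hu] at hF
    intro h
    apply hF
    rw [ht]
    linear_combination - h / 2

/-- decomposition of length `m` -/
def Dec {N : ℕ} (H : Matrix (Fin N) (Fin N) ℂ) (m : ℕ) : Prop :=
  ∃ v : Fin m → (Fin N → ℂ), (∀ j, v j ⬝ᵥ v j = 0) ∧ H = ∑ j, vecMulVec (v j) (v j)

lemma Dec.succ {N : ℕ} {H : Matrix (Fin N) (Fin N) ℂ} {m : ℕ} {v : Fin N → ℂ} (hv : v ⬝ᵥ v = 0)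
    (h : Dec (defl H v) m) : Dec H (m + 1) := by
  obtain ⟨w, hw, hH⟩ := h
  refine ⟨Fin.cons v w, ?_, ?_⟩
  · intro j
    refine Fin.cases ?_ ?_ j
    · simpa using hv
    · intro i; simpa using hw i
  · rw [Fin.sum_univ_succ]
    simp only [Fin.cons_zero, Fin.cons_succ]
    rw [← hH, defl]; simp

lemma dec_zero {N m : ℕ} : Dec (0 : Matrix (Fin N) (Fin N) ℂ) m :=
  ⟨fun _ => 0, by simp, by symm; apply Finset.sum_eq_zero; intro j _; ext; simp [vecMulVec_apply]⟩

lemma dec_of_rank_le {N : ℕ} (m : ℕ) : ∀ {H : Matrix (Fin N) (Fin N) ℂ}, H.IsSymm →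
    H.trace = 0 → (H * H).rank ≠ 1 → H.rank ≤ m → Dec H m := by
  induction m with
  | zero =>
    intro H hs htr h2 hr
    rw [mrank_eq_zero (Nat.le_zero.1 hr)]
    exact dec_zero
  | succ m ih =>
    intro H hs htr h2 hr
    by_cases h0 : H = 0
    · rw [h0]; exact dec_zero
    obtain ⟨u, hu, hz, hD⟩ := step hs htr h2 h0
    have hv : (H *ᵥ u) ⬝ᵥ (H *ᵥ u) = 0 := by rw [dot_self hs, hz]
    have := defl_rank_lt hs hu
    exact Dec.succ hv (ih (defl_symm hs _) (defl_trace htr hv) hD (by omega))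

lemma Dec.rank_le {N m : ℕ} {H : Matrix (Fin N) (Fin N) ℂ} (h : Dec H m) : H.rank ≤ m := by
  obtain ⟨v, -, rfl⟩ := h
  exact mrank_sum_le _ (fun j => rank_vecMulVec_le _ _)

lemma exc_upper {N : ℕ} {H : Matrix (Fin N) (Fin N) ℂ} (hs : H.IsSymm) (htr : H.trace = 0)
    (h1 : (H * H).rank = 1) : Dec H (H.rank + 2) := by
  have h0 : H ≠ 0 := by rintro rfl; simp at h1
  have h3 := T4 htr h1
  have htr2 : (H * H).trace = 0 := by
    have hn : IsNilpotent (H * H) := ⟨2, by rw [sq, ← mul_assoc, h3, zero_mul]⟩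
    exact (Matrix.isNilpotent_trace_of_isNilpotent hn).eq_zero
  have hN : 2 ≤ N := by
    by_contra! hN
    have : N = 0 ∨ N = 1 := by omega
    rcases this with rfl | rfl
    · exact h0 (Subsingleton.elim _ _)
    · apply h0
      ext i j
      have : i = 0 := Subsingleton.elim _ _
      have : j = 0 := Subsingleton.elim _ _
      subst_vars
      simpa [Matrix.trace] using htr
  obtain ⟨v, hv, hv2⟩ := key0 (G := (1 : Matrix (Fin N) (Fin N) ℂ)) (F := H) isSymm_one hs
    (by rw [rank_one]; simpa using hN) (by
      intro a ha
      rw [ha] at htr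
      simp at htr
      apply h0
      rcases htr with h | h
      · rw [ha, h, zero_smul]
      · omega)
  have hv : v ⬝ᵥ v = 0 := by simpa [bf] using hv
  have hD : Dec (defl H v) (H.rank + 1) := by
    refine dec_of_rank_le _ (defl_symm hs v) (defl_trace htr hv) ?_ ?_
    · apply rank_sq_ne_one (defl_trace htr hv)
      rw [defl_sq_trace hs hv, htr2]
      simpa using hv2
    · have : defl H v = H + vecMulVec (-v) v := by
        rw [defl, neg_vecMulVec, sub_eq_add_neg]
      rw [this]
      have := mrank_add_le H (vecMulVec (-v) v)
      have := rank_vecMulVec_le (-v) v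
      omega
  exact Dec.succ hv hD

lemma exc_lower {N m : ℕ} {H : Matrix (Fin N) (Fin N) ℂ} (hs : H.IsSymm)
    (h1 : (H * H).rank = 1) (hd : Dec H m) : H.rank + 2 ≤ m := by
  obtain ⟨v, hv, hH⟩ := hd
  -- the span of the vectors
  set B : Matrix (Fin N) (Fin m) ℂ := Matrix.of (fun i j => v j i) with hB
  have hBB : H = B * Bᵀ := by
    rw [hH]
    ext i k
    simp [Matrix.mul_apply, Matrix.sum_apply, vecMulVec_apply, hB]
  have hBj : ∀ j, B *ᵥ Pi.single j 1 = v j := by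
    intro j; ext i; simp [hB]
  have hle : LinearMap.range H.mulVecLin ≤ LinearMap.range B.mulVecLin := by
    rw [hBB, mulVecLin_mul]; exact LinearMap.range_comp_le_range _ _
  have hBm : B.rank ≤ m := by simpa using rank_le_width B
  have hHB : H.rank ≤ B.rank := Submodule.finrank_mono hle
  have hne : H.rank ≠ B.rank := by
    intro he
    have heq := Submodule.eq_of_le_of_finrank_eq hle he
    have hall : ∀ j, H *ᵥ v j = 0 := by
      intro j
      have : v j ∈ LinearMap.range H.mulVecLin := by
        rw [heq]; exact ⟨Pi.single j 1, hBj j⟩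
      obtain ⟨u, hu⟩ := this
      rw [mulVecLin_apply] at hu
      have hz := hv j
      rw [← hu, dot_self hs] at hz
      obtain ⟨a, b, hab⟩ := rank_one_form h1.le
      have hsym2 := vecMul_symm (mulself_symm hs) u
      rw [← hu, mulVec_mulVec]
      rw [hab, bf_vecMulVec] at hz
      rcases mul_eq_zero.1 hz with h | h
      · rw [← hsym2, hab, vecMul_vecMulVec, h, zero_smul]
      · rw [hab, vecMulVec_mulVec, h]; simp
    have : H * H = 0 := by
      have h5 : H * H = (∑ j, vecMulVec (v j) (v j)) * H := by rw [← hH]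
      rw [h5, Finset.sum_mul]
      apply Finset.sum_eq_zero
      intro j _
      rw [vecMulVec_mul, vecMul_symm hs, hall]
      ext; simp [vecMulVec_apply]
    simp [this] at h1
  have hne2 : B.rank ≠ m := by
    intro he
    have hsurj : LinearMap.range Bᵀ.mulVecLin = ⊤ := by
      apply Submodule.eq_top_of_finrank_eq
      change Bᵀ.rank = _
      rw [rank_transpose, he]; simp
    have : LinearMap.range H.mulVecLin = LinearMap.range B.mulVecLin := by
      rw [hBB, mulVecLin_mul, LinearMap.range_comp, hsurj, LinearMap.range_eq_map]
    apply hne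
    unfold Matrix.rank
    rw [this]
  omega

/-- Classification of the isotropic rank of symmetric trace-zero matrices:
`irk H = rank H + 2` when `H` is nilpotent with `rank H² = 1`, and
`irk H = rank H` otherwise. -/
theorem stmt6 (n : ℕ) (H : Matrix (Fin (n + 1)) (Fin (n + 1)) ℂ)
    (hsym : H.IsSymm) (htr : H.trace = 0) :
    (IsNilpotent H ∧ (H ^ 2).rank = 1 → irkM H = H.rank + 2) ∧
    (¬ (IsNilpotent H ∧ (H ^ 2).rank = 1) → irkM H = H.rank) := by
  have hset : irkM H = sInf {r : ℕ | Dec H r} := rfl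
  rw [hset, sq]
  constructor
  · rintro ⟨-, h1⟩
    have hm := exc_upper hsym htr h1
    exact le_antisymm (Nat.sInf_le hm) (le_csInf ⟨_, hm⟩ (fun m hd => exc_lower hsym h1 hd))
  · intro h
    have h1 : (H * H).rank ≠ 1 := by
      intro h1
      exact h ⟨⟨3, by rw [pow_succ, sq, T4 htr h1]⟩, h1⟩
    have hm := dec_of_rank_le H.rank hsym htr h1 le_rfl
    exact le_antisymm (Nat.sInf_le hm) (le_csInf ⟨_, hm⟩ (fun m hd => hd.rank_le))
end

section
/- Let n ≥ 1 and let H ∈ ℂ^{(n+1)×(n+1)} be an invertible symmetric matrix with trace(H) = 0. Then irk(H) = rank(H) = n + 1. -/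
open Matrix

def OGood {m : ℕ} (B : Matrix (Fin m) (Fin m) ℂ) : Prop :=
  ∃ Q : Matrix (Fin m) (Fin m) ℂ, Qᵀ * Q = 1 ∧ ∀ i, (Qᵀ * B * Q) i i = 0

lemma householder {k : ℕ} (e : Fin (k+1) → ℂ) (he : e ⬝ᵥ e = 1) :
    ∃ Q : Matrix (Fin (k+1)) (Fin (k+1)) ℂ, Qᵀ * Q = 1 ∧
      ∃ σ : ℂ, σ * σ = 1 ∧ Q *ᵥ (Pi.single 0 1) = σ • e := by
  have key : ∃ σ : ℂ, σ * σ = 1 ∧ 1 - σ * e 0 ≠ 0 := by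
    by_cases h : 1 - e 0 = 0
    · refine ⟨-1, by ring, ?_⟩
      have : e 0 = 1 := by linear_combination -h
      rw [this]; norm_num
    · exact ⟨1, by ring, by simpa using h⟩
  obtain ⟨σ, hσ, h0⟩ := key
  set v : Fin (k+1) → ℂ := Pi.single 0 1 - σ • e with hv
  have hvv : v ⬝ᵥ v = 2 * (1 - σ * e 0) := by
    simp only [hv, sub_dotProduct, dotProduct_sub, smul_dotProduct, dotProduct_smul, he,
      single_dotProduct, dotProduct_single, smul_eq_mul, Pi.sub_apply, Pi.smul_apply,
      Pi.single_eq_same]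
    linear_combination hσ
  set c : ℂ := 1 / (1 - σ * e 0) with hc
  have hcc : c * (1 - σ * e 0) = 1 := by rw [hc]; field_simp
  refine ⟨1 - c • vecMulVec v v, ?_, σ, hσ, ?_⟩
  · have hT : (1 - c • vecMulVec v v)ᵀ = 1 - c • vecMulVec v v := by
      simp [transpose_vecMulVec]
    have h2 : vecMulVec v v * vecMulVec v v = (v ⬝ᵥ v) • vecMulVec v v := by
      ext i j
      simp [vecMulVec_mul_vecMulVec, vecMulVec_apply]; ring
    have h4 : ∀ X : Matrix (Fin (k+1)) (Fin (k+1)) ℂ, (1 - X) * (1 - X) = 1 - X - X + X * X := by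
      intro X; noncomm_ring
    rw [hT, h4, smul_mul_smul_comm, h2, smul_smul, hvv]
    have : c * c * (2 * (1 - σ * e 0)) = 2 * c := by linear_combination 2 * c * hcc
    rw [this]
    module
  · have h3 : v ⬝ᵥ Pi.single 0 1 = 1 - σ * e 0 := by
      simp [hv]
    rw [sub_mulVec, one_mulVec, smul_mulVec, vecMulVec_mulVec, h3]
    ext i
    simp only [Pi.sub_apply, Pi.smul_apply, smul_eq_mul, MulOpposite.smul_eq_mul_unop,
      MulOpposite.unop_op]
    rw [show c * (v i * (1 - σ * e 0)) = v i by linear_combination v i * hcc]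
    simp [hv]

lemma good_of_block {k : ℕ} (M : Matrix (Fin (k+1)) (Fin (k+1)) ℂ) (h0 : M 0 0 = 0)
    (h : OGood (M.submatrix Fin.succ Fin.succ)) : OGood M := by
  obtain ⟨R, hR, hd⟩ := h
  refine ⟨Matrix.of (Fin.cons (Fin.cons 1 0) (fun i => Fin.cons 0 (R i))), ?_, ?_⟩
  · ext i j
    have := fun i j => congrFun (congrFun hR i) j
    refine Fin.cases ?_ (fun i => ?_) i <;> refine Fin.cases ?_ (fun j => ?_) j
    · simp [mul_apply, Fin.sum_univ_succ]
    · simp [mul_apply, Fin.sum_univ_succ, one_apply, (Fin.succ_ne_zero _).symm]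
    · simp [mul_apply, Fin.sum_univ_succ, one_apply]
    · have := this i j
      simp only [mul_apply, transpose_apply] at this
      simp [mul_apply, Fin.sum_univ_succ, one_apply, this]
  · intro i
    refine Fin.cases ?_ (fun i => ?_) i
    · simp [mul_apply, Fin.sum_univ_succ, h0]
    · have := hd i
      simp only [mul_apply, transpose_apply, submatrix_apply] at this
      simp [mul_apply, Fin.sum_univ_succ, this]

lemma good_conj {m : ℕ} (B Q : Matrix (Fin m) (Fin m) ℂ) (hQ : Qᵀ * Q = 1)
    (h : OGood (Qᵀ * B * Q)) : OGood B := by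
  obtain ⟨R, hR, hd⟩ := h
  refine ⟨Q * R, ?_, ?_⟩
  · rw [transpose_mul, Matrix.mul_assoc, ← Matrix.mul_assoc Qᵀ, hQ, Matrix.one_mul, hR]
  · intro i; rw [← hd i]; simp only [transpose_mul, Matrix.mul_assoc]

def Dich (k : ℕ) : Prop := ∀ C : Matrix (Fin k) (Fin k) ℂ, C.IsSymm → C.trace = 0 →
  OGood C ∨ ∃ w, w ≠ 0 ∧ C = vecMulVec w w

lemma step_unit {k : ℕ} (ih : Dich k) (B : Matrix (Fin (k+1)) (Fin (k+1)) ℂ) (hs : B.IsSymm)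
    (ht : B.trace = 0) (e : Fin (k+1) → ℂ) (he : e ⬝ᵥ e = 1) (hq : e ⬝ᵥ B *ᵥ e = 0) :
    OGood B ∨ ∃ w : Fin (k+1) → ℂ, w ≠ 0 ∧ w ⬝ᵥ e = 0 ∧ w ⬝ᵥ w = 0 ∧
      ∀ x y, x ⬝ᵥ e = 0 → y ⬝ᵥ e = 0 → x ⬝ᵥ B *ᵥ y = (w ⬝ᵥ x) * (w ⬝ᵥ y) := by
  obtain ⟨Q, hQ, σ, hσ, hQe⟩ := householder e he
  have hQ' : Q * Qᵀ = 1 := mul_eq_one_comm.mp hQ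
  set M := Qᵀ * B * Q with hM
  have hMs : M.IsSymm := by
    unfold Matrix.IsSymm
    simp only [hM, transpose_mul, transpose_transpose, hs.eq, Matrix.mul_assoc]
  have hMt : M.trace = 0 := by
    rw [hM, trace_mul_comm, ← Matrix.mul_assoc, hQ', Matrix.one_mul, ht]
  have hform : ∀ x y, x ⬝ᵥ B *ᵥ y = (Qᵀ *ᵥ x) ⬝ᵥ M *ᵥ (Qᵀ *ᵥ y) := by
    intro x y
    rw [hM, mulVec_mulVec, Matrix.mul_assoc, hQ', Matrix.mul_one, mulVec_transpose,
      ← mulVec_mulVec, ← dotProduct_mulVec, mulVec_mulVec, hQ', one_mulVec]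
  have hdot : ∀ x y, x ⬝ᵥ y = (Qᵀ *ᵥ x) ⬝ᵥ (Qᵀ *ᵥ y) := by
    intro x y
    rw [mulVec_transpose, ← dotProduct_mulVec, mulVec_mulVec, hQ', one_mulVec]
  have hQte : Qᵀ *ᵥ e = σ • Pi.single 0 1 := by
    have : e = σ • Q *ᵥ (Pi.single 0 1) := by rw [hQe, smul_smul, hσ, one_smul]
    rw [this, mulVec_smul, mulVec_mulVec, hQ, one_mulVec]
  have hσ0 : σ ≠ 0 := by rintro rfl; simp at hσ
  have hM0 : M 0 0 = 0 := by
    rw [hform, hQte] at hq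
    simp [mulVec_smul] at hq
    rcases hq with h | h
    · exact absurd h hσ0
    · exact h
  have hCt : (M.submatrix Fin.succ Fin.succ).trace = 0 := by
    simpa [Matrix.trace, Fin.sum_univ_succ, hM0] using hMt
  rcases ih (M.submatrix Fin.succ Fin.succ) (hMs.submatrix _) hCt with h | ⟨w, hw, hC⟩
  · exact Or.inl (good_conj B Q hQ (good_of_block M hM0 h))
  · right
    have hperp : ∀ x, x ⬝ᵥ e = 0 → (Qᵀ *ᵥ x) 0 = 0 := by
      intro x hx
      rw [hdot, hQte] at hx
      simpa [hσ0] using hx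
    have hQw : Qᵀ *ᵥ (Q *ᵥ (Fin.cons 0 w : Fin (k+1) → ℂ)) = (Fin.cons 0 w : Fin (k+1) → ℂ) := by
      rw [mulVec_mulVec, hQ, one_mulVec]
    refine ⟨Q *ᵥ (Fin.cons 0 w : Fin (k+1) → ℂ), ?_, ?_, ?_, ?_⟩
    · intro h
      rw [h, mulVec_zero] at hQw
      apply hw
      ext i
      have := congrFun hQw i.succ
      simpa using this.symm
    · rw [hdot, hQw, hQte]; simp
    · rw [hdot, hQw]
      rw [hC] at hCt
      simpa [dotProduct, Fin.sum_univ_succ, Matrix.trace, vecMulVec_apply] using hCt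
    · intro x y hx hy
      have hx0 := hperp x hx
      have hy0 := hperp y hy
      rw [hform, hdot _ x, hdot _ y, hQw]
      generalize Qᵀ *ᵥ x = X at *
      generalize Qᵀ *ᵥ y = Y at *
      have hC' : ∀ i j : Fin k, M i.succ j.succ = w i * w j := by
        intro i j
        have := congrFun (congrFun hC i) j
        simpa [vecMulVec_apply] using this
      simp only [dotProduct, mulVec, Fin.sum_univ_succ, hx0, hy0, hC', Fin.cons_zero, Fin.cons_succ]
      simp only [zero_mul, mul_zero, zero_add, Finset.sum_mul, Finset.mul_sum, Finset.sum_const_zero]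
      rw [Finset.sum_comm]
      refine Finset.sum_congr rfl fun i _ => Finset.sum_congr rfl fun j _ => by ring


lemma step_nonunit {k : ℕ} (ih : Dich k) (B : Matrix (Fin (k+1)) (Fin (k+1)) ℂ) (hs : B.IsSymm)
    (ht : B.trace = 0) (e : Fin (k+1) → ℂ) (he : e ⬝ᵥ e ≠ 0) (hq : e ⬝ᵥ B *ᵥ e = 0) :
    OGood B ∨ ∃ w : Fin (k+1) → ℂ, w ≠ 0 ∧ w ⬝ᵥ e = 0 ∧ w ⬝ᵥ w = 0 ∧
      ∀ x y, x ⬝ᵥ e = 0 → y ⬝ᵥ e = 0 → x ⬝ᵥ B *ᵥ y = (w ⬝ᵥ x) * (w ⬝ᵥ y) := by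
  obtain ⟨z, hz⟩ := IsAlgClosed.exists_pow_nat_eq (e ⬝ᵥ e) (n := 2) (by norm_num)
  have hz0 : z ≠ 0 := by rintro rfl; apply he; rw [← hz]; ring
  have h1 : (z⁻¹ • e) ⬝ᵥ (z⁻¹ • e) = 1 := by
    simp only [smul_dotProduct, dotProduct_smul, smul_eq_mul, ← hz]; field_simp
  have h2 : (z⁻¹ • e) ⬝ᵥ B *ᵥ (z⁻¹ • e) = 0 := by
    simp only [smul_dotProduct, dotProduct_smul, mulVec_smul, hq, smul_zero]
  rcases step_unit ih B hs ht _ h1 h2 with h | ⟨w, hw, hwe, hww, hb⟩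
  · exact Or.inl h
  · refine Or.inr ⟨w, hw, ?_, hww, fun x y hx hy => hb x y ?_ ?_⟩
    · simpa [hz0] using hwe
    · simp [hx]
    · simp [hy]

lemma form_pair {m : ℕ} (B : Matrix (Fin m) (Fin m) ℂ) (i j : Fin m) :
    (Pi.single i 1 : Fin m → ℂ) ⬝ᵥ B *ᵥ (Pi.single j 1) = B i j := by
  simp

/-- Existence of a nonisotropic vector annihilated by the form. -/
lemma exists_vec {k : ℕ} (B : Matrix (Fin (k+1)) (Fin (k+1)) ℂ) (hs : B.IsSymm)
    (ht : B.trace = 0) (hb : ¬ ∃ w, w ≠ 0 ∧ B = vecMulVec w w) :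
    ∃ e : Fin (k+1) → ℂ, e ⬝ᵥ e ≠ 0 ∧ e ⬝ᵥ B *ᵥ e = 0 := by
  by_contra hno
  have hno' : ∀ e : Fin (k+1) → ℂ, e ⬝ᵥ B *ᵥ e = 0 → e ⬝ᵥ e = 0 := by
    intro e h; by_contra h'; exact hno ⟨e, h', h⟩
  have hs' : ∀ i j, B i j = B j i := fun i j => hs.apply j i
  have hd : ∀ i, B i i ≠ 0 := by
    intro i h
    have := hno' (Pi.single i 1) (by rw [form_pair]; exact h)
    simp at this
  have hpair : ∀ i j, i ≠ j → ∀ c : ℂ, B i i * c^2 + 2 * B i j * c + B j j = 0 → c^2 = -1 := by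
    intro i j hij c hc
    have := hno' (c • Pi.single i 1 + Pi.single j 1) (by
      simp only [add_dotProduct, dotProduct_add, mulVec_add, mulVec_smul, smul_dotProduct,
        dotProduct_smul, form_pair, smul_eq_mul, hs' j i]
      linear_combination hc)
    simp only [add_dotProduct, dotProduct_add, smul_dotProduct,
        dotProduct_smul, smul_eq_mul, single_dotProduct, Pi.single_eq_same,
        Pi.single_eq_of_ne hij, Pi.single_eq_of_ne hij.symm] at this
    linear_combination this
  have hcase : ∀ i j, i ≠ j → (B j j = B i i) ∨ (B j j = - B i i ∧ B i j ^ 2 = - B i i ^ 2) := by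
    intro i j hij
    obtain ⟨z, hz⟩ := IsAlgClosed.exists_pow_nat_eq (B i j ^ 2 - B i i * B j j) (n := 2)
      (by norm_num)
    have ha := hd i
    have h1 := hpair i j hij ((- B i j + z) / B i i) (by field_simp; linear_combination hz)
    have h2 := hpair i j hij ((- B i j - z) / B i i) (by field_simp; linear_combination hz)
    field_simp at h1 h2
    have h3 : B i j * z = 0 := by linear_combination (h2 - h1) / 4
    rcases mul_eq_zero.mp h3 with h | h
    · left
      rw [h] at h1 hz
      apply mul_left_cancel₀ ha
      linear_combination -h1 + hz
    · right
      rw [h] at h1 hz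
      refine ⟨mul_left_cancel₀ ha ?_, ?_⟩
      · linear_combination h1 + hz
      · linear_combination h1
  have htri : ∀ i j l, i ≠ j → i ≠ l → j ≠ l → B j j = B i i → B l l = - B i i → B i j = 0 →
      False := by
    intro i j l hij hil hjl h1 h2 h3
    have ha := hd i
    have hb1 : B i l ^ 2 = - B i i ^ 2 := by
      rcases hcase i l hil with h | h
      · exact absurd (by linear_combination (h - h2) / (-2) : B i i = 0) ha
      · exact h.2
    have hb2 : B j l ^ 2 = - B i i ^ 2 := by
      rcases hcase j l hjl with h | h
      · exact absurd (by linear_combination (h + h1 - h2) / (-2) : B i i = 0) ha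
      · rw [h.2, h1]
    have := hno' ((-(B i l / B i i)) • Pi.single i 1 + (-(2 * B j l / B i i)) • Pi.single j 1
        + Pi.single l 1) (by
      simp only [add_dotProduct, dotProduct_add, mulVec_add, mulVec_smul, smul_dotProduct,
        dotProduct_smul, form_pair, smul_eq_mul, hs' j i, hs' l i, hs' l j, h1, h2, h3]
      field_simp
      linear_combination - B i i * hb1)
    simp only [add_dotProduct, dotProduct_add, smul_dotProduct,
        dotProduct_smul, smul_eq_mul, single_dotProduct, Pi.single_eq_same,
        Pi.single_eq_of_ne hij, Pi.single_eq_of_ne hij.symm, Pi.single_eq_of_ne hil,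
        Pi.single_eq_of_ne hil.symm, Pi.single_eq_of_ne hjl, Pi.single_eq_of_ne hjl.symm] at this
    field_simp at this
    have h4 : B i i ^ 2 = 0 := by linear_combination (this - hb1 - 4 * hb2) / (-4)
    exact ha (by simpa using h4)
  have hoff : ∀ i j, i ≠ j → B j j = B i i → B i j = 0 := by
    intro i j hij h
    obtain ⟨z, hz⟩ := IsAlgClosed.exists_pow_nat_eq (B i j ^ 2 - B i i * B j j) (n := 2)
      (by norm_num)
    have ha := hd i
    have h1 := hpair i j hij ((- B i j + z) / B i i) (by field_simp; linear_combination hz)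
    rw [h] at hz
    field_simp at h1
    have h2 : B i j * (B i j - z) = 0 := by linear_combination (h1 - hz) / 2
    have h3 := hpair i j hij ((- B i j - z) / B i i) (by field_simp; rw [h]; linear_combination hz)
    field_simp at h3
    have h4 : B i j ^ 2 = 0 := by linear_combination (h1 + h3) / 4 - hz / 2
    simpa using h4
  obtain ⟨i, hi⟩ : ∃ i, B i i ≠ B 0 0 := by
    by_contra hall
    push Not at hall
    have : B.trace = (k + 1) * B 0 0 := by
      simp [Matrix.trace, hall]
    rw [ht] at this
    have hk : (k : ℂ) + 1 ≠ 0 := by exact_mod_cast Nat.succ_ne_zero k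
    exact (mul_ne_zero hk (hd 0)) this.symm
  have h0i : (0 : Fin (k+1)) ≠ i := by rintro rfl; exact hi rfl
  obtain ⟨hii, h0i2⟩ := (hcase 0 i h0i).resolve_left hi
  have huniv : ∀ j, j = 0 ∨ j = i := by
    intro j
    by_contra hj
    push Not at hj
    obtain ⟨hj0, hji⟩ := hj
    rcases hcase 0 j hj0.symm with h | h
    · exact htri 0 j i hj0.symm h0i hji h hii (hoff 0 j hj0.symm h)
    · have hh : B j j = B i i := by rw [h.1, hii]
      exact htri i j 0 hji.symm h0i.symm hj0 hh (by rw [hii]; ring) (hoff i j hji.symm hh)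
  obtain ⟨z, hz⟩ := IsAlgClosed.exists_pow_nat_eq (B 0 0) (n := 2) (by norm_num)
  have ha := hd 0
  have hz0 : z ≠ 0 := by rintro rfl; apply ha; rw [← hz]; ring
  refine hb ⟨fun j => B 0 j / z, ?_, ?_⟩
  · intro h
    have := congrFun h 0
    simp [hz0, ha] at this
  · have hgen : ∀ x y, B x y * B 0 0 = B 0 x * B 0 y := by
      intro x y
      rcases huniv x with rfl | rfl <;> rcases huniv y with rfl | rfl
      · ring
      · ring
      · rw [hs' x 0]
      · rw [hii]; linear_combination -h0i2
    ext x y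
    simp only [vecMulVec_apply]
    field_simp
    rw [hz]
    exact hgen x y

lemma exists_s (p r : ℂ) (hr : r ≠ 0) : ∃ s : ℂ, s ≠ 0 ∧ 8 * s^3 - 4 * p * s^2 + r^4 ≠ 0 ∧
    s * (s - p)^2 - r^4 ≠ 0 := by
  open Polynomial in
  set P1 : ℂ[X] := 8 * X^3 - 4 * C p * X^2 + C (r^4) with hP1
  set P2 : ℂ[X] := X * (X - C p)^2 - C (r^4) with hP2
  have h1 : P1 ≠ 0 := by
    intro h
    have := congrArg (Polynomial.eval 0) h
    simp [hP1, hr] at this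
  have h2 : P2 ≠ 0 := by
    intro h
    have := congrArg (Polynomial.eval 0) h
    simp [hP2, hr] at this
  have h3 : Polynomial.X * P1 * P2 ≠ 0 := mul_ne_zero (mul_ne_zero Polynomial.X_ne_zero h1) h2
  obtain ⟨s, hs⟩ : ∃ s, Polynomial.eval s (Polynomial.X * P1 * P2) ≠ 0 := by
    by_contra hall
    push Not at hall
    exact h3 (Polynomial.funext fun s => by simpa using hall s)
  simp only [Polynomial.eval_mul, Polynomial.eval_X, mul_ne_zero_iff] at hs
  refine ⟨s, hs.1.1, ?_, ?_⟩
  · simpa [hP1] using hs.1.2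
  · simpa [hP2] using hs.2

lemma ext_form {m : ℕ} (B : Matrix (Fin m) (Fin m) ℂ) (w : Fin m → ℂ)
    (h : ∀ x y, x ⬝ᵥ B *ᵥ y = (w ⬝ᵥ x) * (w ⬝ᵥ y)) : B = vecMulVec w w := by
  ext i j
  rw [← form_pair B i j, h]
  simp [vecMulVec_apply]

lemma dich_succ {k : ℕ} (ih : Dich k) : Dich (k+1) := by
  intro B hs ht
  by_cases hbad : ∃ w, w ≠ 0 ∧ B = vecMulVec w w
  · exact Or.inr hbad
  left
  by_contra hng
  have step := fun e he hq => (step_nonunit ih B hs ht e he hq).resolve_left hng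
  obtain ⟨e0, he0, hq0⟩ := exists_vec B hs ht hbad
  obtain ⟨z, hz⟩ := IsAlgClosed.exists_pow_nat_eq (e0 ⬝ᵥ e0) (n := 2) (by norm_num)
  have hz0 : z ≠ 0 := by rintro rfl; apply he0; rw [← hz]; ring
  obtain ⟨e, hee, hqe⟩ : ∃ e : Fin (k+1) → ℂ, e ⬝ᵥ e = 1 ∧ e ⬝ᵥ B *ᵥ e = 0 := by
    refine ⟨z⁻¹ • e0, ?_, ?_⟩
    · simp only [smul_dotProduct, dotProduct_smul, smul_eq_mul, ← hz]; field_simp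
    · simp only [smul_dotProduct, dotProduct_smul, mulVec_smul, hq0, smul_zero]
  obtain ⟨w, hw, hwe, hww, hb⟩ := step e (by rw [hee]; exact one_ne_zero) hqe
  have hsymm : ∀ x y, x ⬝ᵥ B *ᵥ y = y ⬝ᵥ B *ᵥ x := by
    intro x y
    rw [dotProduct_mulVec, ← mulVec_transpose, hs.eq, dotProduct_comm]
  set u := B *ᵥ e with hu
  have hue : u ⬝ᵥ e = 0 := by rw [dotProduct_comm]; exact hqe
  -- the normal form
  have hform : ∀ x y, x ⬝ᵥ B *ᵥ y = (e ⬝ᵥ x) * (u ⬝ᵥ y) + (e ⬝ᵥ y) * (u ⬝ᵥ x)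
      + (w ⬝ᵥ x) * (w ⬝ᵥ y) := by
    intro x y
    have h := hb (x - (e ⬝ᵥ x) • e) (y - (e ⬝ᵥ y) • e)
      (by simp [sub_dotProduct, hee, dotProduct_comm x e])
      (by simp [sub_dotProduct, hee, dotProduct_comm y e])
    simp only [sub_dotProduct, dotProduct_sub, mulVec_sub, mulVec_smul, smul_dotProduct,
      dotProduct_smul, smul_eq_mul, hwe, ← hu, hqe] at h
    rw [hsymm e y, ← hu, dotProduct_comm x u, dotProduct_comm y u] at h
    linear_combination h
  have hnz : ∀ w' : Fin (k+1) → ℂ, w' ≠ 0 → ∃ x, w' ⬝ᵥ x ≠ 0 := by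
    intro w' h
    by_contra hall
    push Not at hall
    exact h (dotProduct_eq_zero_iff.mp hall)
  clear_value u
  by_cases hr : u ⬝ᵥ w = 0
  · -- degenerate case
    have hq1 : ∀ t : ℂ, (e + t • w) ⬝ᵥ B *ᵥ (e + t • w) = 0 := by
      intro t
      rw [hform]
      simp only [dotProduct_add, dotProduct_smul, smul_eq_mul, hue, hr, hwe, hww]
      ring
    have hn1 : ∀ t : ℂ, (e + t • w) ⬝ᵥ (e + t • w) = 1 := by
      intro t
      simp only [add_dotProduct, smul_dotProduct, dotProduct_add, dotProduct_smul, smul_eq_mul,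
        dotProduct_comm e w, hee, hwe, hww]
      ring
    obtain ⟨w1, hw1, -, -, hb1⟩ := step (e + (1:ℂ) • w) (by rw [hn1]; exact one_ne_zero) (hq1 1)
    have hprop : ∀ x y, (w ⬝ᵥ x) * (u ⬝ᵥ y) = (w ⬝ᵥ y) * (u ⬝ᵥ x) := by
      have hX : ∀ x, (x - ((e + (1:ℂ) • w) ⬝ᵥ x) • e) ⬝ᵥ (e + (1:ℂ) • w) = 0 := by
        intro x
        simp only [sub_dotProduct, smul_dotProduct, dotProduct_add, dotProduct_smul, smul_eq_mul,
          add_dotProduct, dotProduct_comm e w, hee, hwe, dotProduct_comm x]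
        ring
      have hF : ∀ x y, (x - ((e + (1:ℂ) • w) ⬝ᵥ x) • e) ⬝ᵥ B *ᵥ (y - ((e + (1:ℂ) • w) ⬝ᵥ y) • e)
          = (w ⬝ᵥ x) * (w ⬝ᵥ y) - (w ⬝ᵥ x) * (u ⬝ᵥ y) - (w ⬝ᵥ y) * (u ⬝ᵥ x) := by
        intro x y
        rw [hform]
        simp only [dotProduct_sub, dotProduct_smul, smul_eq_mul,
          add_dotProduct, smul_dotProduct, hee, hwe, hue]
        ring
      intro x y
      have hxx := hb1 _ _ (hX x) (hX x)
      have hxy := hb1 _ _ (hX x) (hX y)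
      have hyy := hb1 _ _ (hX y) (hX y)
      rw [hF] at hxx hxy hyy
      have : ((w ⬝ᵥ x) * (u ⬝ᵥ y) - (w ⬝ᵥ y) * (u ⬝ᵥ x))^2 = 0 := by
        have e1 := congrArg₂ (· * ·) hxx hyy
        have e2 := congrArg₂ (· * ·) hxy hxy
        linear_combination e2 - e1
      exact sub_eq_zero.mp (by simpa using this)
    obtain ⟨x0, hx0⟩ := hnz w hw
    obtain ⟨c, hc⟩ : ∃ c : ℂ, ∀ y, u ⬝ᵥ y = c * (w ⬝ᵥ y) := by
      refine ⟨(u ⬝ᵥ x0) / (w ⬝ᵥ x0), fun y => ?_⟩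
      field_simp
      linear_combination hprop x0 y
    by_cases hc0 : c = 0
    · apply hbad
      refine ⟨w, hw, ext_form B w fun x y => ?_⟩
      rw [hform, hc, hc, hc0]; ring
    · obtain ⟨w2, hw2, hw2e, -, hb2⟩ := step (e + (1 / (2 * c)) • w)
        (by rw [hn1]; exact one_ne_zero) (hq1 _)
      obtain ⟨x, hx⟩ := hnz w2 hw2
      set f := e + (1 / (2 * c)) • w with hf
      have hXf : (x - (f ⬝ᵥ x) • f) ⬝ᵥ f = 0 := by
        rw [sub_dotProduct, smul_dotProduct, hn1, dotProduct_comm x]; simp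
      have h := hb2 _ _ hXf hXf
      have hE : e ⬝ᵥ (x - (f ⬝ᵥ x) • f) = - (1 / (2 * c)) * (w ⬝ᵥ (x - (f ⬝ᵥ x) • f)) := by
        rw [dotProduct_comm] at hXf
        nth_rewrite 1 [hf] at hXf
        rw [add_dotProduct, smul_dotProduct, smul_eq_mul] at hXf
        linear_combination hXf
      have hw2x : w2 ⬝ᵥ (x - (f ⬝ᵥ x) • f) = w2 ⬝ᵥ x := by
        rw [dotProduct_sub, dotProduct_smul, hw2e]; simp
      rw [hform, hw2x, hE, hc] at h
      apply hx
      have h5 : (w2 ⬝ᵥ x)^2 = 0 := by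
        rw [pow_two, ← h]; field_simp; ring
      simpa using h5
  · -- generic case
    obtain ⟨s, hs0, hs1, hs2⟩ := exists_s (u ⬝ᵥ u) (u ⬝ᵥ w) hr
    set p := u ⬝ᵥ u with hp
    set r := u ⬝ᵥ w with hr'
    have hwu : w ⬝ᵥ u = r := by rw [dotProduct_comm]
    have heu : e ⬝ᵥ u = 0 := by rw [dotProduct_comm]; exact hue
    have hew : e ⬝ᵥ w = 0 := by rw [dotProduct_comm]; exact hwe
    set α := - r^2 / (2 * s) with hα
    set γ := (s - p) / r with hγ
    have hα' : 2 * s * α = - r^2 := by rw [hα]; field_simp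
    have hγ' : r * γ = s - p := by rw [hγ]; field_simp
    clear_value α γ p r
    obtain ⟨w3, -, -, -, hb3⟩ := step (α • e + u + γ • w)
      (by
        simp only [add_dotProduct, smul_dotProduct, dotProduct_add, dotProduct_smul, smul_eq_mul,
          hee, heu, hew, hue, hwe, hww, hwu, ← hp, ← hr']
        intro h
        apply hs1
        linear_combination (4 * s^2) * h - 8 * s^2 * hγ' - (2 * s * α - r^2) * hα')
      (by
        rw [hform]
        simp only [dotProduct_add, dotProduct_smul, smul_eq_mul,
          hee, heu, hew, hue, hwe, hww, hwu, ← hp, ← hr']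
        linear_combination hα' + 2 * α * hγ')
    have hx : (e - (α / r) • w) ⬝ᵥ (α • e + u + γ • w) = 0 := by
      simp only [sub_dotProduct, smul_dotProduct, dotProduct_add, dotProduct_smul, smul_eq_mul,
          hee, heu, hew, hue, hwe, hww, hwu, ← hp, ← hr']
      field_simp
      ring
    have hy : ((1 / r) • u - ((γ + p / r) / r) • w) ⬝ᵥ (α • e + u + γ • w) = 0 := by
      simp only [sub_dotProduct, smul_dotProduct, dotProduct_add, dotProduct_smul, smul_eq_mul,
          hee, heu, hew, hue, hwe, hww, hwu, ← hp, ← hr']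
      field_simp
      ring
    have h1 := hb3 _ _ hx hx
    have h2 := hb3 _ _ hx hy
    have h3 := hb3 _ _ hy hy
    rw [hform] at h1 h2 h3
    generalize w3 ⬝ᵥ (e - (α / r) • w) = a at h1 h2 h3
    generalize w3 ⬝ᵥ ((1 / r) • u - ((γ + p / r) / r) • w) = b at h1 h2 h3
    simp only [dotProduct_sub, dotProduct_smul, smul_eq_mul,
          hee, heu, hew, hue, hwe, hww, hwu, ← hp, ← hr'] at h1 h2 h3
    have k1 : a * a = -2 * α := by rw [← h1]; field_simp; ring
    have k2 : a * b = -γ := by rw [← h2]; field_simp; ring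
    have k3 : b * b = 1 := by rw [← h3]; field_simp; ring
    have k4 : γ^2 = -2 * α := by
      linear_combination a * a * k3 + k1 - (a * b - γ) * k2
    apply hs2
    linear_combination r^2 * s * k4 - s * (r * γ + s - p) * hγ' - r^2 * hα'

lemma dich_all : ∀ k, Dich k
  | 0 => fun C _ _ => Or.inl ⟨1, by simp, fun i => i.elim0⟩
  | k+1 => dich_succ (dich_all k)

lemma exists_factor {m : ℕ} (H : Matrix (Fin m) (Fin m) ℂ) (hs : H.IsSymm) (hu : IsUnit H) :
    ∃ A : Matrix (Fin m) (Fin m) ℂ, H = A * Aᵀ := by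
  set q : QuadraticForm ℂ (Fin m → ℂ) :=
    LinearMap.BilinMap.toQuadraticMap (Matrix.toLinearMap₂' ℂ H) with hq
  have hsymm : ∀ x y, x ⬝ᵥ H *ᵥ y = y ⬝ᵥ H *ᵥ x := by
    intro x y
    rw [dotProduct_mulVec, ← mulVec_transpose, hs.eq, dotProduct_comm]
  have hqx : ∀ x, q x = x ⬝ᵥ H *ᵥ x := by
    intro x; simp [hq, Matrix.toLinearMap₂'_apply']
  have hassoc : ∀ x y, QuadraticMap.associated (R := ℂ) q x y = x ⬝ᵥ H *ᵥ y := by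
    intro x y
    rw [QuadraticMap.associated_apply]
    simp only [hqx, add_dotProduct, dotProduct_add, mulVec_add, hsymm y x]
    simp
    ring
  have hsep : (QuadraticMap.associated (R := ℂ) q).SeparatingLeft := by
    intro x hx
    have h1 : x ᵥ* H = 0 := by
      apply dotProduct_eq_zero_iff.mp
      intro y
      rw [← dotProduct_mulVec, ← hassoc, hx]
    exact (Matrix.vecMul_injective_of_isUnit hu) (by simpa using h1)
  obtain ⟨d, hd, ⟨L⟩⟩ : ∃ d, d = m ∧
      QuadraticMap.Equivalent q (QuadraticMap.weightedSumSquares ℂ (1 : Fin d → ℂ)) :=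
    ⟨_, Module.finrank_fin_fun ℂ, QuadraticForm.equivalent_weightedSumSquares_of_isAlgClosed q hsep⟩
  subst hd
  have hL : ∀ x, L x ⬝ᵥ L x = x ⬝ᵥ H *ᵥ x := by
    intro x
    rw [← hqx, ← L.map_app x, QuadraticMap.weightedSumSquares_apply]
    simp [dotProduct]
  have hpol : ∀ x y, L x ⬝ᵥ L y = x ⬝ᵥ H *ᵥ y := by
    intro x y
    have h1 := hL (x + y)
    have hadd : L (x + y) = L x + L y := map_add L.toLinearEquiv x y
    simp only [hadd, add_dotProduct, dotProduct_add, mulVec_add, hsymm y x,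
      dotProduct_comm (L y) (L x), hL] at h1
    linear_combination h1 / 2
  refine ⟨Matrix.of fun i j => L (Pi.single i 1) j, ?_⟩
  ext i j
  rw [← form_pair H i j, ← hpol]
  simp [mul_apply, dotProduct]

lemma sum_eq_mul {m r : ℕ} (v : Fin r → (Fin m → ℂ)) :
    ∑ j, vecMulVec (v j) (v j) = (Matrix.of v)ᵀ * Matrix.of v := by
  ext a b
  simp [mul_apply, Matrix.sum_apply, vecMulVec_apply]

/-- An invertible symmetric trace-zero matrix has isotropic rank equal to its
rank, namely `n + 1`. -/
theorem stmt7 (n : ℕ) (hn : 1 ≤ n) (H : Matrix (Fin (n + 1)) (Fin (n + 1)) ℂ)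
    (hsym : H.IsSymm) (htr : H.trace = 0) (hinv : IsUnit H) :
    irkM H = n + 1 ∧ H.rank = n + 1 := by
  have hrank : H.rank = n + 1 := by
    rw [rank_of_isUnit H hinv, Fintype.card_fin]
  refine ⟨le_antisymm (Nat.sInf_le ?_) (le_csInf ?_ ?_), hrank⟩
  rotate_left 2
  · rintro r ⟨v, -, hv⟩
    rw [sum_eq_mul] at hv
    rw [← hrank, hv]
    exact (rank_mul_le_left _ _).trans (rank_le_width _)
  all_goals
    have main : n + 1 ∈ {r : ℕ | ∃ v : Fin r → (Fin (n+1) → ℂ),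
      (∀ j, v j ⬝ᵥ v j = 0) ∧ H = ∑ j, vecMulVec (v j) (v j)} := by
      obtain ⟨A, hA⟩ := exists_factor H hsym hinv
      have hAu : IsUnit A.det := by
        have := (Matrix.isUnit_iff_isUnit_det H).mp hinv
        rw [hA, det_mul] at this
        exact isUnit_of_mul_isUnit_left this
      rcases dich_all (n+1) (Aᵀ * A) (by simp [Matrix.IsSymm, transpose_mul])
        (by rw [trace_mul_comm, ← hA, htr]) with ⟨Q, hQ, hd⟩ | ⟨w, -, hw⟩
      · have hQ' : Q * Qᵀ = 1 := mul_eq_one_comm.mp hQ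
        refine ⟨fun j i => (A * Q) i j, fun j => ?_, ?_⟩
        · have h := hd j
          have h2 : Qᵀ * (Aᵀ * A) * Q = (A * Q)ᵀ * (A * Q) := by
            simp only [transpose_mul, Matrix.mul_assoc]
          rw [h2] at h
          rw [← h, mul_apply]
          rfl
        · rw [sum_eq_mul]
          have h3 : (Matrix.of fun j i => (A * Q) i j) = (A * Q)ᵀ := rfl
          rw [h3, transpose_transpose, transpose_mul, Matrix.mul_assoc, ← Matrix.mul_assoc Q, hQ',
            Matrix.one_mul, hA]
      · exfalso
        have h1 : (Aᵀ * A).rank = n + 1 := by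
          rw [rank_of_isUnit, Fintype.card_fin]
          rw [Matrix.isUnit_iff_isUnit_det, det_mul, det_transpose]
          exact hAu.mul hAu
        have h2 := rank_vecMulVec_le w w
        rw [← hw, h1] at h2
        omega
  · exact main
  · exact ⟨_, main⟩
end

section
/- Let n ≥ 1 and let H ∈ ℂ^{(n+1)×(n+1)} be an invertible symmetric matrix with trace(H) = 0. Then there exist vectors v_0,…,v_n ∈ ℂ^{n+1} such that v_iᵀ H v_i = 0 for every i = 0,…,n, v_iᵀ v_j = 0 for all 0 ≤ i < j ≤ n, and v_iᵀ v_i ≠ 0 for every i = 0,…,n. -/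
open Matrix

/-- Polynomial functions. -/
def PF {m : ℕ} (f : (Fin m → ℂ) → ℂ) : Prop :=
  ∃ P : MvPolynomial (Fin m) ℂ, ∀ u, MvPolynomial.eval u P = f u

namespace PF
variable {m : ℕ} {f g : (Fin m → ℂ) → ℂ}

lemma add (hf : PF f) (hg : PF g) : PF (fun u => f u + g u) := by
  obtain ⟨P, hP⟩ := hf
  obtain ⟨Q, hQ⟩ := hg
  exact ⟨P + Q, fun u => by simp [hP, hQ]⟩

lemma sub (hf : PF f) (hg : PF g) : PF (fun u => f u - g u) := by
  obtain ⟨P, hP⟩ := hf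
  obtain ⟨Q, hQ⟩ := hg
  exact ⟨P - Q, fun u => by simp [hP, hQ]⟩

lemma mul (hf : PF f) (hg : PF g) : PF (fun u => f u * g u) := by
  obtain ⟨P, hP⟩ := hf
  obtain ⟨Q, hQ⟩ := hg
  exact ⟨P * Q, fun u => by simp [hP, hQ]⟩

lemma const (c : ℂ) : PF (fun _ : Fin m → ℂ => c) := ⟨MvPolynomial.C c, fun u => by simp⟩

lemma lin (x : Fin m → ℂ) : PF (fun u => x ⬝ᵥ u) :=
  ⟨∑ i, MvPolynomial.C (x i) * MvPolynomial.X i, fun u => by simp [dotProduct]⟩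

lemma quad (A : Matrix (Fin m) (Fin m) ℂ) : PF (fun u => u ⬝ᵥ A *ᵥ u) :=
  ⟨∑ i, MvPolynomial.X i * ∑ j, MvPolynomial.C (A i j) * MvPolynomial.X j,
    fun u => by simp [dotProduct, mulVec]⟩

lemma eq_zero (hf : PF f) (hg : PF g) (h : ∀ u, f u * g u = 0) :
    (∀ u, f u = 0) ∨ (∀ u, g u = 0) := by
  obtain ⟨P, hP⟩ := hf
  obtain ⟨Q, hQ⟩ := hg
  have : P * Q = 0 := MvPolynomial.funext fun u => by simp [hP, hQ, h]
  rcases mul_eq_zero.1 this with h | h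
  · left; intro u; rw [← hP, h, map_zero]
  · right; intro u; rw [← hQ, h, map_zero]
end PF

lemma symm_dot {m : ℕ} {A : Matrix (Fin m) (Fin m) ℂ} (hA : A.IsSymm) (x y : Fin m → ℂ) :
    x ⬝ᵥ A *ᵥ y = y ⬝ᵥ A *ᵥ x := by
  rw [dotProduct_mulVec, ← mulVec_transpose, hA.eq, dotProduct_comm]

/-- value of the form `A` at the parametrised point of the cone of `H`. -/
def FA {m : ℕ} (H A : Matrix (Fin m) (Fin m) ℂ) (w u : Fin m → ℂ) : ℂ :=
  (u ⬝ᵥ H *ᵥ u) * (u ⬝ᵥ H *ᵥ u) * (w ⬝ᵥ A *ᵥ w)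
    - 4 * (u ⬝ᵥ H *ᵥ u) * ((H *ᵥ w) ⬝ᵥ u) * ((A *ᵥ w) ⬝ᵥ u)
    + 4 * ((H *ᵥ w) ⬝ᵥ u) * ((H *ᵥ w) ⬝ᵥ u) * (u ⬝ᵥ A *ᵥ u)

def pt {m : ℕ} (H : Matrix (Fin m) (Fin m) ℂ) (w u : Fin m → ℂ) : Fin m → ℂ :=
  (u ⬝ᵥ H *ᵥ u) • w - (2 * ((H *ᵥ w) ⬝ᵥ u)) • u

lemma FA_eq {m : ℕ} (H A : Matrix (Fin m) (Fin m) ℂ) (hA : A.IsSymm) (w u : Fin m → ℂ) :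
    pt H w u ⬝ᵥ A *ᵥ pt H w u = FA H A w u := by
  have h1 : (A *ᵥ w) ⬝ᵥ u = w ⬝ᵥ A *ᵥ u := by rw [dotProduct_comm, symm_dot hA]
  have h2 := symm_dot hA u w
  simp only [pt, FA, mulVec_sub, mulVec_smul, sub_dotProduct, dotProduct_sub, smul_dotProduct,
    dotProduct_smul, smul_eq_mul, h1, h2]
  ring

lemma FA_PF {m : ℕ} (H A : Matrix (Fin m) (Fin m) ℂ) (w : Fin m → ℂ) : PF (FA H A w) := by
  unfold FA
  exact ((((PF.quad H).mul (PF.quad H)).mul (PF.const _)).sub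
    ((((PF.const 4).mul (PF.quad H)).mul (PF.lin _)).mul (PF.lin _))).add
    ((((PF.const 4).mul (PF.lin _)).mul (PF.lin _)).mul (PF.quad A))

lemma pt_iso {m : ℕ} (H : Matrix (Fin m) (Fin m) ℂ) (hH : H.IsSymm) (w u : Fin m → ℂ)
    (hw : w ⬝ᵥ H *ᵥ w = 0) : pt H w u ⬝ᵥ H *ᵥ pt H w u = 0 := by
  rw [FA_eq H H hH, FA, hw]; ring

lemma ext_quad {m : ℕ} {A B : Matrix (Fin m) (Fin m) ℂ} (hA : A.IsSymm) (hB : B.IsSymm)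
    (h : ∀ u, u ⬝ᵥ A *ᵥ u = u ⬝ᵥ B *ᵥ u) : A = B := by
  ext i j
  have h1 := h (Pi.single i 1 + Pi.single j 1)
  have h2 := h (Pi.single i 1)
  have h3 := h (Pi.single j 1)
  have h4 := hA.apply i j
  have h5 := hB.apply i j
  simp [mulVec_add, add_dotProduct, dotProduct_add] at h1 h2 h3
  rw [h2, h3, h4, h5] at h1
  linear_combination h1 / 2

/-- on the hyperplane `w^⊥` the form `H` is nonzero. -/
lemma exists_aniso {m : ℕ} (hm : 3 ≤ m) (H : Matrix (Fin m) (Fin m) ℂ) (hH : H.IsSymm)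
    (hinj : ∀ x, H *ᵥ x = 0 → x = 0) (w x0 : Fin m → ℂ) (hx0 : (H *ᵥ w) ⬝ᵥ x0 = 1) :
    ∃ u, (H *ᵥ w) ⬝ᵥ u = 0 ∧ u ⬝ᵥ H *ᵥ u ≠ 0 := by
  by_contra! hc
  have hpol : ∀ x y, (H *ᵥ w) ⬝ᵥ x = 0 → (H *ᵥ w) ⬝ᵥ y = 0 → y ⬝ᵥ H *ᵥ x = 0 := by
    intro x y hx hy
    have h := hc (x + y) (by rw [dotProduct_add, hx, hy, add_zero])
    have h2 := symm_dot hH x y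
    simp only [mulVec_add, add_dotProduct, dotProduct_add, hc x hx, hc y hy, h2] at h
    linear_combination h / 2
  have hker : ∀ x, (H *ᵥ w) ⬝ᵥ x = 0 → x = (x0 ⬝ᵥ H *ᵥ x) • w := by
    intro x hx
    refine sub_eq_zero.1 (hinj _ ?_)
    refine dotProduct_eq_zero _ fun y => ?_
    have h := hpol x (y - ((H *ᵥ w) ⬝ᵥ y) • x0) hx (by
      rw [dotProduct_sub, dotProduct_smul, hx0]; simp)
    rw [dotProduct_comm]
    simp only [mulVec_sub, mulVec_smul, sub_dotProduct, dotProduct_sub, smul_dotProduct,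
      dotProduct_smul, smul_eq_mul] at h ⊢
    rw [dotProduct_comm y (H *ᵥ w)]
    linear_combination h
  have hspan : Submodule.span ℂ (({w, x0} : Finset (Fin m → ℂ)) : Set (Fin m → ℂ)) = ⊤ := by
    rw [eq_top_iff]
    intro x _
    have h := hker (x - ((H *ᵥ w) ⬝ᵥ x) • x0) (by
      rw [dotProduct_sub, dotProduct_smul, hx0]; simp)
    rw [Finset.coe_pair, Submodule.mem_span_pair]
    exact ⟨_, _, (sub_eq_iff_eq_add.1 h).symm⟩
  have h1 := finrank_span_finset_le_card (R := ℂ) ({w, x0} : Finset (Fin m → ℂ))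
  have h2 := Finset.card_le_two (a := w) (b := x0)
  rw [Set.finrank, hspan, finrank_top, Module.finrank_fin_fun] at h1
  omega

lemma exists_dual {m : ℕ} (y : Fin m → ℂ) (hy : y ≠ 0) : ∃ x, y ⬝ᵥ x = 1 := by
  obtain ⟨i, hi⟩ := Function.ne_iff.1 hy
  refine ⟨Pi.single i (y i)⁻¹, ?_⟩
  rw [dotProduct_single]
  exact mul_inv_cancel₀ hi

lemma prop_of_FA {m : ℕ} (hm : 3 ≤ m) (H A : Matrix (Fin m) (Fin m) ℂ) (hH : H.IsSymm)
    (hA : A.IsSymm) (hinj : ∀ x, H *ᵥ x = 0 → x = 0) (w : Fin m → ℂ) (hw0 : w ≠ 0)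
    (h : ∀ u, FA H A w u = 0) : ∃ c : ℂ, A = c • H := by
  obtain ⟨x0, hx0⟩ := exists_dual (H *ᵥ w) (fun h => hw0 (hinj _ h))
  obtain ⟨u0, hu0, hu0'⟩ := exists_aniso hm H hH hinj w x0 hx0
  have hAw : w ⬝ᵥ A *ᵥ w = 0 := by
    have := h u0
    simp only [FA, hu0] at this
    simpa [hu0'] using this
  have h1 : ∀ u, (u ⬝ᵥ H *ᵥ u) * ((A *ᵥ w) ⬝ᵥ u) - ((H *ᵥ w) ⬝ᵥ u) * (u ⬝ᵥ A *ᵥ u) = 0 := by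
    refine (PF.eq_zero (PF.lin (H *ᵥ w)) (((PF.quad H).mul (PF.lin (A *ᵥ w))).sub
      ((PF.lin (H *ᵥ w)).mul (PF.quad A))) fun u => ?_).resolve_left fun h => ?_
    · have := h u
      rw [FA, hAw] at this
      linear_combination - this / 4
    · have := h x0
      rw [hx0] at this
      exact one_ne_zero this
  have h2 : ∀ u, (H *ᵥ w) ⬝ᵥ u = 0 → u ⬝ᵥ H *ᵥ u ≠ 0 → (A *ᵥ w) ⬝ᵥ u = 0 := by
    intro u hu hu'
    have := h1 u
    rw [hu] at this
    simpa [hu'] using this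
  have h3 : ∀ u, (H *ᵥ w) ⬝ᵥ u = 0 → (A *ᵥ w) ⬝ᵥ u = 0 := by
    intro u hu
    by_cases hz : u ⬝ᵥ H *ᵥ u = 0
    · have e1 := h2 u0 hu0 hu0'
      have e2 := h2 (u + u0) (by rw [dotProduct_add, hu, hu0, add_zero])
      have e3 := h2 (u - u0) (by rw [dotProduct_sub, hu, hu0, sub_zero])
      rw [dotProduct_add, e1, add_zero] at e2
      rw [dotProduct_sub, e1, sub_zero] at e3
      by_contra hne
      have e4 := not_not.1 (mt e2 hne)
      have e5 := not_not.1 (mt e3 hne)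
      simp only [mulVec_add, mulVec_sub, sub_dotProduct, dotProduct_sub, add_dotProduct,
        dotProduct_add, hz] at e4 e5
      apply hu0'
      linear_combination (e4 + e5) / 2
    · exact h2 u hu hz
  set c := (A *ᵥ w) ⬝ᵥ x0
  have h4 : ∀ u, (A *ᵥ w) ⬝ᵥ u = c * ((H *ᵥ w) ⬝ᵥ u) := by
    intro u
    have := h3 (u - ((H *ᵥ w) ⬝ᵥ u) • x0) (by rw [dotProduct_sub, dotProduct_smul, hx0]; simp)
    rw [dotProduct_sub, dotProduct_smul, smul_eq_mul] at this
    linear_combination this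
  have h5 : ∀ u, c * (u ⬝ᵥ H *ᵥ u) - u ⬝ᵥ A *ᵥ u = 0 := by
    refine (PF.eq_zero (PF.lin (H *ᵥ w)) (((PF.const c).mul (PF.quad H)).sub
      (PF.quad A)) fun u => ?_).resolve_left fun h => ?_
    · have := h1 u
      rw [h4] at this
      linear_combination this
    · have := h x0
      rw [hx0] at this
      exact one_ne_zero this
  refine ⟨c, ext_quad hA (hH.smul c) fun u => ?_⟩
  rw [smul_mulVec, dotProduct_smul, smul_eq_mul]
  linear_combination - h5 u

lemma exists_iso {m : ℕ} (hm : 2 ≤ m) (H : Matrix (Fin m) (Fin m) ℂ) (hH : H.IsSymm) :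
    ∃ w : Fin m → ℂ, w ≠ 0 ∧ w ⬝ᵥ H *ᵥ w = 0 := by
  let i : Fin m := ⟨0, by omega⟩
  let j : Fin m := ⟨1, by omega⟩
  have hij : i ≠ j := by simp [i, j]
  by_cases h : H j j = 0
  · refine ⟨Pi.single j 1, by simp, by simp [h]⟩
  obtain ⟨s, hs⟩ := IsAlgClosed.exists_eq_mul_self (H i j ^ 2 - H i i * H j j)
  refine ⟨Pi.single i 1 + Pi.single j ((- H i j + s) / H j j), ?_, ?_⟩
  · intro h0
    have := congrFun h0 i
    simp [hij] at this
  · have h4 := hH.apply i j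
    simp [mulVec_add, add_dotProduct, dotProduct_add, mulVec_single, h4]
    field_simp
    linear_combination -hs

lemma lemmaB {m : ℕ} (hm : 3 ≤ m) (H A : Matrix (Fin m) (Fin m) ℂ) (hH : H.IsSymm)
    (hA : A.IsSymm) (hinj : ∀ x, H *ᵥ x = 0 → x = 0) (htr : H.trace = 0)
    (hne : ∀ c : ℂ, A ≠ c • H) :
    ∃ v, v ⬝ᵥ H *ᵥ v = 0 ∧ v ⬝ᵥ v ≠ 0 ∧ v ⬝ᵥ A *ᵥ v ≠ 0 := by
  obtain ⟨w, hw0, hw⟩ := exists_iso (by omega) H hH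
  by_contra! hc
  have := PF.eq_zero (FA_PF H 1 w) (FA_PF H A w) fun u => by
    rw [← FA_eq H 1 isSymm_one, ← FA_eq H A hA, mul_eq_zero, one_mulVec, or_iff_not_imp_left]
    exact hc _ (pt_iso H hH w u hw)
  rcases this with h | h
  · obtain ⟨c, hc⟩ := prop_of_FA hm H 1 hH isSymm_one hinj w hw0 h
    have := congrArg trace hc
    rw [trace_smul, htr, trace_one] at this
    simp at this
    omega
  · obtain ⟨c, hc⟩ := prop_of_FA hm H A hH hA hinj w hw0 h
    exact hne c hc

/-- Orthonormal frame of the complement of a unit vector. -/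
lemma exists_frame {m : ℕ} (v : Fin (m + 1) → ℂ) (hv : v ⬝ᵥ v = 1) :
    ∃ E : Matrix (Fin (m + 1)) (Fin m) ℂ, Eᵀ * E = 1 ∧ E * Eᵀ = 1 - vecMulVec v v := by
  have key : ∃ O : Matrix (Fin (m + 1)) (Fin (m + 1)) ℂ, Oᵀ * O = 1 ∧
      ∀ i j, O i 0 * O j 0 = v i * v j := by
    have hx : ∃ e : ℂ, e * e = 1 ∧ 1 - e * v 0 ≠ 0 := by
      by_cases h : v 0 = 1
      · exact ⟨-1, by norm_num, by rw [h]; norm_num⟩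
      · exact ⟨1, by norm_num, by rw [one_mul]; exact sub_ne_zero.2 (Ne.symm h)⟩
    obtain ⟨e, he, hne⟩ := hx
    -- x = v - e • e0
    let x : Fin (m + 1) → ℂ := v - Pi.single 0 e
    have hxx : x ⬝ᵥ x = 2 * (1 - e * v 0) := by
      simp only [x, sub_dotProduct, dotProduct_sub, hv, dotProduct_single, single_dotProduct]
      simp
      linear_combination he
    have hx0 : x 0 = v 0 - e := by simp [x]
    refine ⟨1 - (1 - e * v 0)⁻¹ • vecMulVec x x, ?_, ?_⟩
    · rw [transpose_sub, transpose_smul, transpose_one, transpose_vecMulVec]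
      have hsq : vecMulVec x x * vecMulVec x x = (2 * (1 - e * v 0)) • vecMulVec x x := by
        rw [← hxx]
        ext i j
        simp only [mul_apply, vecMulVec_apply, Matrix.smul_apply, dotProduct, smul_eq_mul,
          Finset.sum_mul]
        exact Finset.sum_congr rfl fun k _ => by ring
      simp only [Matrix.sub_mul, Matrix.mul_sub, Matrix.one_mul, Matrix.mul_one, Matrix.smul_mul,
        Matrix.mul_smul, hsq]
      ext i j
      simp [vecMulVec_apply]
      field_simp
      ring
    · have hcol : ∀ i, (1 - (1 - e * v 0)⁻¹ • vecMulVec x x) i 0 = e * v i := by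
        intro i
        simp only [Matrix.sub_apply, Matrix.smul_apply, vecMulVec_apply, hx0, smul_eq_mul]
        refine Fin.cases ?_ (fun k => ?_) i
        · rw [hx0]
          simp
          field_simp
          linear_combination (v 0 ^ 2 - 1) * he
        · simp [x]
          field_simp
          linear_combination (v k.succ * v 0) * he
      intro i j
      rw [hcol, hcol]
      linear_combination v i * v j * he
  obtain ⟨O, hO, hcol⟩ := key
  have hO' : O * Oᵀ = 1 := mul_eq_one_comm.1 hO
  refine ⟨O.submatrix id Fin.succ, ?_, ?_⟩
  · ext i j
    have := congrFun (congrFun hO i.succ) j.succ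
    simp [mul_apply, one_apply] at this ⊢
    exact this
  · ext i j
    have := congrFun (congrFun hO' i) j
    simp only [mul_apply, Fin.sum_univ_succ, transpose_apply, hcol] at this
    simp only [mul_apply, Matrix.sub_apply, vecMulVec_apply, transpose_apply, submatrix_apply, id]
    linear_combination this

/-- The conclusion. -/
def Good {m : ℕ} (H : Matrix (Fin m) (Fin m) ℂ) : Prop :=
  ∃ v : Fin m → (Fin m → ℂ),
      (∀ i, v i ⬝ᵥ H *ᵥ (v i) = 0) ∧
      (∀ i j, i < j → v i ⬝ᵥ v j = 0) ∧
      (∀ i, v i ⬝ᵥ v i ≠ 0)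

lemma frame_orth {m : ℕ} {v : Fin (m + 1) → ℂ} (hv : v ⬝ᵥ v = 1)
    {E : Matrix (Fin (m + 1)) (Fin m) ℂ} (h1 : Eᵀ * E = 1) (h2 : E * Eᵀ = 1 - vecMulVec v v) :
    Eᵀ *ᵥ v = 0 := by
  have h : E *ᵥ (Eᵀ *ᵥ v) = 0 := by
    rw [mulVec_mulVec, h2, sub_mulVec, one_mulVec, vecMulVec_mulVec, hv]
    simp
  have := congrArg (Eᵀ *ᵥ ·) h
  simp only [mulVec_zero] at this
  rwa [mulVec_mulVec, h1, one_mulVec] at this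

lemma dot_frame {k m : ℕ} (E : Matrix (Fin k) (Fin m) ℂ) (x : Fin k → ℂ) (y : Fin m → ℂ) :
    x ⬝ᵥ E *ᵥ y = (Eᵀ *ᵥ x) ⬝ᵥ y := by
  rw [dotProduct_mulVec, mulVec_transpose]

lemma lift_good {m : ℕ} {H : Matrix (Fin (m + 1)) (Fin (m + 1)) ℂ} {v : Fin (m + 1) → ℂ}
    (hv : v ⬝ᵥ v = 1) (hHv : v ⬝ᵥ H *ᵥ v = 0)
    {E : Matrix (Fin (m + 1)) (Fin m) ℂ} (h1 : Eᵀ * E = 1) (h2 : E * Eᵀ = 1 - vecMulVec v v)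
    (hg : Good (Eᵀ * H * E)) : Good H := by
  obtain ⟨z, hz1, hz2, hz3⟩ := hg
  have hE := frame_orth hv h1 h2
  have hdot : ∀ x y, (E *ᵥ x) ⬝ᵥ (E *ᵥ y) = x ⬝ᵥ y := by
    intro x y
    rw [dot_frame, mulVec_mulVec, h1, one_mulVec]
  refine ⟨Fin.cons v (fun i => E *ᵥ z i), ?_, ?_, ?_⟩
  · refine Fin.cases ?_ fun i => ?_
    · simpa using hHv
    · simp only [Fin.cons_succ]
      rw [← hz1 i, dotProduct_comm, dot_frame, dotProduct_comm, mulVec_mulVec, mulVec_mulVec]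
  · refine Fin.cases (Fin.cases (fun h => absurd h (lt_irrefl _)) fun j _ => ?_) fun i =>
      Fin.cases (fun h => absurd h (Fin.not_lt_zero _)) fun j h => ?_
    · simp only [Fin.cons_succ, Fin.cons_zero]
      rw [dot_frame, hE, zero_dotProduct]
    · simp only [Fin.cons_succ, hdot]
      exact hz2 i j (Fin.succ_lt_succ_iff.1 h)
  · refine Fin.cases ?_ fun i => ?_
    · simp [hv]
    · simp only [Fin.cons_succ, hdot]
      exact hz3 i

lemma trace_frame {m : ℕ} {H : Matrix (Fin (m + 1)) (Fin (m + 1)) ℂ} {v : Fin (m + 1) → ℂ}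
    (hHv : v ⬝ᵥ H *ᵥ v = 0) {E : Matrix (Fin (m + 1)) (Fin m) ℂ}
    (h2 : E * Eᵀ = 1 - vecMulVec v v) : (Eᵀ * H * E).trace = H.trace := by
  rw [trace_mul_comm, ← Matrix.mul_assoc, h2, Matrix.sub_mul, Matrix.one_mul, trace_sub, trace_mul_comm, mul_vecMulVec,
    trace_vecMulVec, dotProduct_comm, hHv, sub_zero]

lemma symm_frame {k m : ℕ} {H : Matrix (Fin k) (Fin k) ℂ} (hH : H.IsSymm)
    (E : Matrix (Fin k) (Fin m) ℂ) : (Eᵀ * H * E).IsSymm := by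
  unfold IsSymm
  rw [transpose_mul, transpose_mul, transpose_transpose, hH.eq, Matrix.mul_assoc]

lemma exists_normalize {m : ℕ} (v : Fin m → ℂ) (hv : v ⬝ᵥ v ≠ 0) :
    ∃ t : ℂ, t ≠ 0 ∧ (t • v) ⬝ᵥ (t • v) = 1 := by
  obtain ⟨s, hs⟩ := IsAlgClosed.exists_eq_mul_self (v ⬝ᵥ v)
  have hs0 : s ≠ 0 := by rintro rfl; simp [hs] at hv
  refine ⟨s⁻¹, inv_ne_zero hs0, ?_⟩
  rw [smul_dotProduct, dotProduct_smul, hs]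
  simp only [smul_eq_mul]
  field_simp

/-- The case of scalar square. -/
lemma step_scalar {m : ℕ} {H : Matrix (Fin (m + 2)) (Fin (m + 2)) ℂ} (hH : H.IsSymm)
    (htr : H.trace = 0) (hinj : ∀ x, H *ᵥ x = 0 → x = 0) (c : ℂ) (hc : H * H = c • 1)
    (ih : ∀ H : Matrix (Fin m) (Fin m) ℂ, H.IsSymm → H.trace = 0 →
      (∀ x, H *ᵥ x = 0 → x = 0) → Good H)
    (v : Fin (m + 2) → ℂ) (hv : v ⬝ᵥ v = 1) (hHv : v ⬝ᵥ H *ᵥ v = 0) : Good H := by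
  have hHH : ∀ x, H *ᵥ (H *ᵥ x) = c • x := by
    intro x; rw [mulVec_mulVec, hc, smul_mulVec, one_mulVec]
  have hc0 : c ≠ 0 := by
    rintro rfl
    have : v = 0 := hinj _ (hinj _ (by rw [hHH, zero_smul]))
    simp [this] at hv
  have hq : (H *ᵥ v) ⬝ᵥ (H *ᵥ v) ≠ 0 := by
    rw [symm_dot hH, hHH, dotProduct_smul, hv]
    simpa using hc0
  obtain ⟨t, ht, htw⟩ := exists_normalize _ hq
  set w := t • H *ᵥ v with hw
  have hvw : v ⬝ᵥ w = 0 := by rw [hw, dotProduct_smul, hHv, smul_zero]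
  have hHw : H *ᵥ w = (t * c) • v := by rw [hw, mulVec_smul, hHH, smul_smul]
  have hwHw : w ⬝ᵥ H *ᵥ w = 0 := by
    rw [hHw, dotProduct_smul, dotProduct_comm, hvw, smul_zero]
  obtain ⟨E, hE1, hE2⟩ := exists_frame v hv
  have hEv := frame_orth hv hE1 hE2
  have hEw : E *ᵥ (Eᵀ *ᵥ w) = w := by
    rw [mulVec_mulVec, hE2, sub_mulVec, one_mulVec, vecMulVec_mulVec, hvw]
    simp
  have hw' : (Eᵀ *ᵥ w) ⬝ᵥ (Eᵀ *ᵥ w) = 1 := by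
    rw [← dot_frame, hEw, htw]
  have hHw' : (Eᵀ *ᵥ w) ⬝ᵥ (Eᵀ * H * E) *ᵥ (Eᵀ *ᵥ w) = 0 := by
    rw [← mulVec_mulVec, ← mulVec_mulVec, hEw, dotProduct_comm, ← dot_frame, hEw,
      dotProduct_comm, hwHw]
  obtain ⟨F, hF1, hF2⟩ := exists_frame _ hw'
  have hFw := frame_orth hw' hF1 hF2
  refine lift_good hv hHv hE1 hE2 (lift_good hw' hHw' hF1 hF2 (ih _ ?_ ?_ ?_))
  · exact symm_frame (symm_frame hH E) F
  · rw [trace_frame hHw' hF2, trace_frame hHv hE2, htr]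
  · intro y hy
    set x := E *ᵥ (F *ᵥ y) with hx
    have hxv : v ⬝ᵥ x = 0 := by rw [hx, dot_frame, hEv, zero_dotProduct]
    have hxw : w ⬝ᵥ x = 0 := by rw [hx, dot_frame, dot_frame, hFw, zero_dotProduct]
    have hy' : Fᵀ *ᵥ (Eᵀ *ᵥ (H *ᵥ x)) = 0 := by
      rw [hx, ← hy]; simp only [mulVec_mulVec, Matrix.mul_assoc]
    have hvx : v ⬝ᵥ H *ᵥ x = 0 := by
      have : H *ᵥ v = t⁻¹ • w := by rw [hw, smul_smul, inv_mul_cancel₀ ht, one_smul]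
      rw [symm_dot hH, this, dotProduct_smul, dotProduct_comm, hxw, smul_zero]
    have hwx : w ⬝ᵥ H *ᵥ x = 0 := by
      rw [symm_dot hH, hHw, dotProduct_smul, dotProduct_comm, hxv, smul_zero]
    have hEx : E *ᵥ (Eᵀ *ᵥ (H *ᵥ x)) = H *ᵥ x := by
      rw [mulVec_mulVec _ E Eᵀ, hE2, sub_mulVec, one_mulVec, vecMulVec_mulVec, hvx]
      simp
    have e1 : Eᵀ *ᵥ (H *ᵥ x) = 0 := by
      have := congrArg (F *ᵥ ·) hy'
      simp only [mulVec_zero] at this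
      rw [mulVec_mulVec _ F Fᵀ, hF2, sub_mulVec, one_mulVec, vecMulVec_mulVec, ← dot_frame,
        hEx, hwx] at this
      simpa using this
    have e2 : H *ᵥ x = 0 := by rw [← hEx, e1, mulVec_zero]
    have e3 := hinj _ e2
    have e4 : Fᵀ *ᵥ (Eᵀ *ᵥ x) = y := by
      rw [hx, mulVec_mulVec _ Eᵀ E, hE1, one_mulVec, mulVec_mulVec, hF1, one_mulVec]
    rw [← e4, e3, mulVec_zero, mulVec_zero]

lemma step_generic {m : ℕ} {H A : Matrix (Fin (m + 1)) (Fin (m + 1)) ℂ} (hH : H.IsSymm)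
    (htr : H.trace = 0) (hinj : ∀ x, H *ᵥ x = 0 → x = 0) (hA : A * H = 1)
    (ih : ∀ H : Matrix (Fin m) (Fin m) ℂ, H.IsSymm → H.trace = 0 →
      (∀ x, H *ᵥ x = 0 → x = 0) → Good H)
    (v : Fin (m + 1) → ℂ) (hv : v ⬝ᵥ v = 1) (hHv : v ⬝ᵥ H *ᵥ v = 0)
    (hAv : v ⬝ᵥ A *ᵥ v ≠ 0) : Good H := by
  obtain ⟨E, hE1, hE2⟩ := exists_frame v hv
  have hEv := frame_orth hv hE1 hE2
  refine lift_good hv hHv hE1 hE2 (ih _ (symm_frame hH E) ?_ ?_)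
  · rw [trace_frame hHv hE2, htr]
  · intro y hy
    set x := E *ᵥ y with hx
    have hxv : v ⬝ᵥ x = 0 := by rw [hx, dot_frame, hEv, zero_dotProduct]
    have hy' : Eᵀ *ᵥ (H *ᵥ x) = 0 := by
      rw [hx, ← hy]; simp only [mulVec_mulVec, Matrix.mul_assoc]
    have e1 : H *ᵥ x = (v ⬝ᵥ H *ᵥ x) • v := by
      have := congrArg (E *ᵥ ·) hy'
      simp only [mulVec_zero] at this
      rw [mulVec_mulVec, hE2, sub_mulVec, one_mulVec, vecMulVec_mulVec] at this
      simpa using sub_eq_zero.1 this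
    have e2 : x = (v ⬝ᵥ H *ᵥ x) • A *ᵥ v := by
      have := congrArg (A *ᵥ ·) e1
      simpa [mulVec_mulVec, hA, mulVec_smul] using this
    have e3 : (v ⬝ᵥ H *ᵥ x) = 0 := by
      rw [e2, dotProduct_smul, smul_eq_mul] at hxv
      exact (mul_eq_zero.1 hxv).resolve_right hAv
    rw [e3, zero_smul] at e1
    have e4 : Eᵀ *ᵥ x = y := by rw [hx, mulVec_mulVec, hE1, one_mulVec]
    rw [← e4, hinj _ e1, mulVec_zero]

lemma two_case (H : Matrix (Fin 2) (Fin 2) ℂ) (hH : H.IsSymm)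
    (htr : H.trace = 0) (hinj : ∀ x, H *ᵥ x = 0 → x = 0) :
    (∃ c : ℂ, H * H = c • 1) ∧ ∃ v, v ⬝ᵥ H *ᵥ v = 0 ∧ v ⬝ᵥ v ≠ 0 := by
  have h01 : H 1 0 = H 0 1 := hH.apply 0 1
  rw [trace_fin_two] at htr
  have h11 : H 1 1 = - H 0 0 := by linear_combination htr
  have hdet : H 0 0 ^ 2 + H 0 1 ^ 2 ≠ 0 := by
    intro h
    have h2 := hinj ![H 0 0, H 0 1] (by
      ext i; fin_cases i <;> simp [mulVec, dotProduct, Fin.sum_univ_two, h01, h11]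
      · linear_combination h
      · ring)
    have ha : H 0 0 = 0 := by simpa using congrFun h2 0
    have hb : H 0 1 = 0 := by simpa using congrFun h2 1
    have h3 := hinj ![1, 0] (by
      ext i; fin_cases i <;> simp [mulVec, dotProduct, Fin.sum_univ_two, h01, h11, ha, hb])
    simpa using congrFun h3 0
  refine ⟨⟨H 0 0 ^ 2 + H 0 1 ^ 2, ?_⟩, ?_⟩
  · ext i j
    fin_cases i <;> fin_cases j <;> simp [mul_apply, Fin.sum_univ_two, h01, h11] <;> ring
  · by_cases ha : H 0 0 = 0
    · exact ⟨![1, 0], by simp [mulVec, dotProduct, Fin.sum_univ_two, ha], by simp⟩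
    · obtain ⟨s, hs⟩ := IsAlgClosed.exists_eq_mul_self (H 0 0 ^ 2 + H 0 1 ^ 2)
      have hs0 : s ≠ 0 := by rintro rfl; simp [hs] at hdet
      have key : H 0 0 * ((- H 0 1 + s) / H 0 0) ^ 2 + 2 * H 0 1 * ((- H 0 1 + s) / H 0 0)
          - H 0 0 = 0 := by
        field_simp
        linear_combination -hs
      generalize (- H 0 1 + s) / H 0 0 = x at key
      refine ⟨![x, 1], ?_, ?_⟩
      · simp [mulVec, dotProduct, Fin.sum_univ_two, h01, h11]
        linear_combination key
      · simp [dotProduct, Fin.sum_univ_two]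
        intro h
        apply hdet
        -- x² = -1, so b x = a
        have e : H 0 1 * x = H 0 0 := by linear_combination key / 2 - H 0 0 / 2 * h
        rw [← e]
        linear_combination H 0 1 ^ 2 * h

lemma good_of_inj : ∀ (m : ℕ) (H : Matrix (Fin m) (Fin m) ℂ), H.IsSymm → H.trace = 0 →
      (∀ x, H *ᵥ x = 0 → x = 0) → Good H := by
  intro m
  induction m using Nat.strong_induction_on with
  | _ m ih =>
  intro H hH htr hinj
  have fin_scalar : ∀ c : ℂ, H * H = c • 1 → 2 ≤ m →
      (∃ v, v ⬝ᵥ H *ᵥ v = 0 ∧ v ⬝ᵥ v ≠ 0) → Good H := by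
    rintro c hc hm ⟨v, hv1, hv2⟩
    obtain ⟨k, rfl⟩ := Nat.exists_eq_add_of_le' hm
    obtain ⟨t, ht, htv⟩ := exists_normalize v hv2
    exact step_scalar hH htr hinj c hc (ih k (by omega)) (t • v) htv
      (by rw [mulVec_smul, dotProduct_smul, smul_dotProduct, hv1]; simp)
  rcases Nat.lt_or_ge m 3 with hm | hm
  · interval_cases m
    · exact ⟨fun i => i.elim0, fun i => i.elim0, fun i => i.elim0, fun i => i.elim0⟩
    · exfalso
      have h0 : H 0 0 = 0 := by simpa [trace] using htr
      have h3 := hinj ![1] (by ext i; fin_cases i; simp [mulVec, dotProduct, h0])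
      simpa using congrFun h3 0
    · obtain ⟨⟨c, hc⟩, hv⟩ := two_case H hH htr hinj
      exact fin_scalar c hc le_rfl hv
  · have hu : IsUnit H := by
      rw [← mulVec_injective_iff_isUnit]
      intro x y hxy
      refine sub_eq_zero.1 (hinj _ ?_)
      rw [mulVec_sub]
      exact sub_eq_zero.2 hxy
    have hdet := (isUnit_iff_isUnit_det _).1 hu
    have hA1 := nonsing_inv_mul H hdet
    have hAs : H⁻¹.IsSymm := by
      unfold IsSymm
      rw [transpose_nonsing_inv, hH.eq]
    by_cases hs : ∃ c : ℂ, H⁻¹ = c • H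
    · obtain ⟨c, hc⟩ := hs
      have hc1 : c • (H * H) = 1 := by rw [← smul_mul, ← hc, hA1]
      have hc0 : c ≠ 0 := by
        rintro rfl
        rw [zero_smul] at hc1
        have := congrFun (congrFun hc1 ⟨0, by omega⟩) ⟨0, by omega⟩
        simp at this
      refine fin_scalar c⁻¹ ?_ (by omega) ?_
      · rw [← hc1, smul_smul, inv_mul_cancel₀ hc0, one_smul]
      · have hone : ∀ c : ℂ, (1 : Matrix (Fin m) (Fin m) ℂ) ≠ c • H := by
          intro c hc
          have := congrArg trace hc
          rw [trace_smul, htr, trace_one] at this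
          simp at this
          omega
        obtain ⟨v, h1, h2, -⟩ := lemmaB hm H 1 hH isSymm_one hinj htr hone
        exact ⟨v, h1, h2⟩
    · push Not at hs
      obtain ⟨v, h1, h2, h3⟩ := lemmaB hm H H⁻¹ hH hAs hinj htr hs
      obtain ⟨k, rfl⟩ := Nat.exists_eq_add_of_le' (show 1 ≤ m by omega)
      obtain ⟨t, ht, htv⟩ := exists_normalize v h2
      refine step_generic hH htr hinj hA1 (ih k (by omega)) (t • v) htv
        (by rw [mulVec_smul, dotProduct_smul, smul_dotProduct, h1]; simp) ?_
      rw [mulVec_smul, dotProduct_smul, smul_dotProduct]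
      simp [ht, h3]

/-- For an invertible symmetric trace-zero matrix `H` there is a basis of
vectors isotropic for `H`, pairwise orthogonal and anisotropic for the
standard bilinear form. -/
theorem stmt8 (n : ℕ) (hn : 1 ≤ n) (H : Matrix (Fin (n + 1)) (Fin (n + 1)) ℂ)
    (hsym : H.IsSymm) (htr : H.trace = 0) (hinv : IsUnit H) :
    ∃ v : Fin (n + 1) → (Fin (n + 1) → ℂ),
      (∀ i, v i ⬝ᵥ H.mulVec (v i) = 0) ∧
      (∀ i j, i < j → v i ⬝ᵥ v j = 0) ∧
      (∀ i, v i ⬝ᵥ v i ≠ 0) := by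
  refine good_of_inj (n + 1) H hsym htr fun x hx => ?_
  exact mulVec_injective_iff_isUnit.2 hinv (by rw [hx, mulVec_zero])
end

section
/- Let H ∈ ℂ^{(n+1)×(n+1)} be a symmetric matrix with trace(H) = 0 and rank(H) = r. Suppose there exists a matrix Q ∈ ℂ^{(n+1)×(n+1)} with QᵀQ = I such that the matrix K = Qᵀ H Q satisfies K_{ij} = 0 whenever i = j, or i ≥ r, or j ≥ r (indices ranging over 0,…,n); that is, K is an r-frame hollow matrix. Then irk(H) = r. -/
open Matrix

theorem aux_poly (s : Multiset ℂ) (hs : ∀ a ∈ s, a ≠ 0) :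
    ∃ p : Polynomial ℂ, (s.map (fun a => Polynomial.X - Polynomial.C a)).prod ∣
      p ^ 2 - Polynomial.X := by
  induction s using Multiset.induction_on with
  | empty => exact ⟨0, by simp⟩
  | cons a s ih =>
    obtain ⟨p, g, hg⟩ := ih (fun b hb => hs b (Multiset.mem_cons_of_mem hb))
    have ha : a ≠ 0 := hs a (Multiset.mem_cons_self a s)
    set f := (s.map (fun a => Polynomial.X - Polynomial.C a)).prod with hf
    have hev : p.eval a ^ 2 - a = f.eval a * g.eval a := by
      have := congrArg (Polynomial.eval a) hg
      simpa using this
    obtain ⟨c, hc⟩ : ∃ c : ℂ, g.eval a + 2 * c * p.eval a + c ^ 2 * f.eval a = 0 := by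
      by_cases h0 : f.eval a = 0
      · have hp : p.eval a ≠ 0 := by
          intro h
          rw [h, h0] at hev
          apply ha
          linear_combination -hev
        refine ⟨- g.eval a / (2 * p.eval a), ?_⟩
        rw [h0]
        field_simp
        ring
      · obtain ⟨w, hw⟩ := IsAlgClosed.exists_pow_nat_eq a (n := 2) (by norm_num)
        refine ⟨(w - p.eval a) / f.eval a, ?_⟩
        field_simp
        linear_combination hw - hev
    refine ⟨p + Polynomial.C c * f, ?_⟩
    have hd : Polynomial.X - Polynomial.C a ∣
        g + 2 * Polynomial.C c * p + Polynomial.C c ^ 2 * f := by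
      rw [Polynomial.dvd_iff_isRoot, Polynomial.IsRoot]
      simpa using hc
    obtain ⟨q, hq⟩ := hd
    rw [Multiset.map_cons, Multiset.prod_cons, ← hf]
    exact ⟨q, by linear_combination hg + f * hq⟩

theorem aux_sqrt {r : ℕ} (A : Matrix (Fin r) (Fin r) ℂ) (hA : A.IsSymm) (hu : IsUnit A) :
    ∃ S : Matrix (Fin r) (Fin r) ℂ, Sᵀ = S ∧ S * S = A := by
  have hsp := IsAlgClosed.splits A.charpoly
  obtain ⟨p, g, hg⟩ := aux_poly A.charpoly.roots (by
    intro a ha h0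
    subst h0
    have h1 := (Polynomial.mem_roots'.1 ha).2
    rw [Polynomial.IsRoot, Matrix.eval_charpoly] at h1
    have h2 := (Matrix.isUnit_iff_isUnit_det A).1 hu
    simp [Matrix.det_neg] at h1
    exact h2.ne_zero h1)
  have hprod : (A.charpoly.roots.map (fun a => Polynomial.X - Polynomial.C a)).prod
      = A.charpoly := by
    have := hsp.eq_prod_roots
    rw [A.charpoly_monic.leadingCoeff] at this
    simpa using this.symm
  rw [hprod] at hg
  refine ⟨Polynomial.aeval A p, ?_, ?_⟩
  · rw [Polynomial.aeval_eq_sum_range, Matrix.transpose_sum]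
    simp only [Matrix.transpose_smul, Matrix.transpose_pow, hA.eq]
  · have := congrArg (Polynomial.aeval A) hg
    rw [map_mul, Matrix.aeval_self_charpoly, zero_mul, map_sub, map_pow,
      Polynomial.aeval_X, sub_eq_zero, pow_two] at this
    exact this

theorem aux_sum {m k : ℕ} (V : Matrix (Fin m) (Fin k) ℂ) :
    ∑ j, vecMulVec (fun i => V i j) (fun i => V i j) = V * Vᵀ := by
  ext a b
  simp [Matrix.sum_apply, vecMulVec_apply, Matrix.mul_apply]

/-- If a symmetric trace-zero matrix of rank `r` is orthogonally similar to an
`r`-frame hollow matrix, then its isotropic rank equals `r`. -/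
theorem stmt9 (n r : ℕ) (H : Matrix (Fin (n + 1)) (Fin (n + 1)) ℂ)
    (hsym : H.IsSymm) (htr : H.trace = 0) (hrk : H.rank = r)
    (Q : Matrix (Fin (n + 1)) (Fin (n + 1)) ℂ) (hQ : Qᵀ * Q = 1)
    (hK : ∀ i j : Fin (n + 1),
      (i = j ∨ r ≤ (i : ℕ) ∨ r ≤ (j : ℕ)) → (Qᵀ * H * Q) i j = 0) :
    irkM H = r := by
  have hQ' : Q * Qᵀ = 1 := mul_eq_one_comm.1 hQ
  have hrn : r ≤ n + 1 := by
    rw [← hrk]; simpa using H.rank_le_width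
  set K := Qᵀ * H * Q with hKdef
  have hH : H = Q * K * Qᵀ := by
    calc H = (Q * Qᵀ) * H * (Q * Qᵀ) := by rw [hQ']; simp
      _ = _ := by rw [hKdef]; simp only [Matrix.mul_assoc]
  have hKs : Kᵀ = K := by
    rw [hKdef]
    simp only [Matrix.transpose_mul, Matrix.transpose_transpose, hsym.eq, Matrix.mul_assoc]
  obtain ⟨P, hP⟩ : ∃ P : Matrix (Fin (n + 1)) (Fin r) ℂ,
      ∀ i j, P i j = if i = Fin.castLE hrn j then 1 else 0 := ⟨fun i j => _, fun _ _ => rfl⟩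
  have hPP : Pᵀ * P = 1 := by
    ext a b
    simp [hP, Matrix.mul_apply, Matrix.one_apply, eq_comm]
  have hPP' : P * Pᵀ = diagonal (fun i : Fin (n + 1) => if (i : ℕ) < r then (1 : ℂ) else 0) := by
    ext a b
    by_cases ha : (a : ℕ) < r
    · rw [Matrix.mul_apply, Finset.sum_eq_single ⟨a, ha⟩]
      · simp [hP, Matrix.diagonal_apply, ha, Fin.ext_iff, eq_comm]
      · intro c _ hc
        have : a ≠ Fin.castLE hrn c := by
          intro h; apply hc; ext; simp [h]
        simp [hP, this]
      · simp
    · rw [Matrix.mul_apply, Finset.sum_eq_zero]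
      · simp [Matrix.diagonal_apply, ha]
      · intro c _
        have : a ≠ Fin.castLE hrn c := by
          intro h; apply ha; simp [h]
        simp [hP, this]
  have hKP : P * (Pᵀ * K * P) * Pᵀ = K := by
    have h1 : P * (Pᵀ * K * P) * Pᵀ = (P * Pᵀ) * K * (P * Pᵀ) := by
      simp only [Matrix.mul_assoc]
    rw [h1, hPP']
    ext i j
    rw [Matrix.mul_diagonal, Matrix.diagonal_mul]
    by_cases hi : (i : ℕ) < r
    · by_cases hj : (j : ℕ) < r
      · simp [hi, hj]
      · rw [hK i j (by omega)]; simp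
    · rw [hK i j (by omega)]; simp
  set A := Pᵀ * K * P with hA
  have hAs : A.IsSymm := by
    rw [Matrix.IsSymm, hA]
    simp only [Matrix.transpose_mul, Matrix.transpose_transpose, hKs, Matrix.mul_assoc]
  have hAd : ∀ j, A j j = 0 := by
    intro j
    have : A j j = K (Fin.castLE hrn j) (Fin.castLE hrn j) := by
      simp [hA, hP, Matrix.mul_apply]
    rw [this]
    exact hK _ _ (Or.inl rfl)
  have hAr : r ≤ A.rank := by
    calc r = H.rank := hrk.symm
      _ = ((Q * P) * A * (Pᵀ * Qᵀ)).rank := by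
        congr 1
        rw [hH, ← hKP]; simp only [Matrix.mul_assoc]
      _ ≤ ((Q * P) * A).rank := Matrix.rank_mul_le_left _ _
      _ ≤ A.rank := Matrix.rank_mul_le_right _ _
  have hAu : IsUnit A := by
    rw [← Matrix.linearIndependent_rows_iff_isUnit, linearIndependent_iff_card_le_finrank_span,
      Set.finrank, ← Matrix.rank_eq_finrank_span_row]
    simpa using hAr
  obtain ⟨S, hS, hSS⟩ := aux_sqrt A hAs hAu
  have hmem : r ∈ {r : ℕ | ∃ v : Fin r → (Fin (n + 1) → ℂ),
      (∀ j, v j ⬝ᵥ v j = 0) ∧ H = ∑ j, vecMulVec (v j) (v j)} := by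
    refine ⟨fun j i => (Q * P * S) i j, ?_, ?_⟩
    · intro j
      have h1 : (Q * P * S)ᵀ * (Q * P * S) = A := by
        calc (Q * P * S)ᵀ * (Q * P * S) = Sᵀ * (Pᵀ * (Qᵀ * Q) * P) * S := by
              simp only [Matrix.transpose_mul, Matrix.mul_assoc]
          _ = A := by rw [hQ, Matrix.mul_one, hPP, Matrix.mul_one, hS, hSS]
      have h2 := hAd j
      rw [← h1, Matrix.mul_apply] at h2
      exact h2
    · rw [aux_sum, hH, ← hKP, ← hSS]
      simp only [Matrix.transpose_mul, Matrix.mul_assoc, hS]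
  apply le_antisymm
  · exact Nat.sInf_le hmem
  · refine le_csInf ⟨r, hmem⟩ ?_
    rintro m ⟨v, -, hv⟩
    have h3 := aux_sum (Matrix.of fun i j => v j i)
    have h4 : H = (Matrix.of fun i j => v j i) * (Matrix.of fun i j => v j i)ᵀ := by
      rw [hv, ← h3]; rfl
    calc r = H.rank := hrk.symm
      _ ≤ (Matrix.of fun i j => v j i : Matrix (Fin (n + 1)) (Fin m) ℂ).rank := by
        rw [h4]; exact Matrix.rank_mul_le_left _ _
      _ ≤ m := by simpa using Matrix.rank_le_width _
end
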